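/- arXiv:2604.20294 — 2 statements merged into one kernel-verified Lean document; each statement's English description precedes it below -/
import Mathlib

section
/- Let Y be a uniformly complete Archimedean f-algebra, let X be a sublattice-algebra of Y, and let X̄ be the intersection of all uniformly complete sublattices of Y containing X (a sublattice Z of Y is called uniformly complete if Z is uniformly complete as a vector lattice in its own right). Then: (i) X̄ is a sublattice-algebra of Y (and therefore an f-algebra); and (ii) for every uniformly complete Archimedean f-algebra A and every lattice-algebra homomorphism T : X → A, there exists a unique lattice-algebra homomorphism T̄ : X̄ → A extending T. -/
open scoped BigOperators

/-- A continuous function `ℝⁿ → ℝ` of polynomial growth (an element of `PG_n`). -/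
def PolyGrowth (n : ℕ) (f : (Fin n → ℝ) → ℝ) : Prop :=
  Continuous f ∧ ∃ (M : ℝ) (N : ℕ), 0 ≤ M ∧
    ∀ t : Fin n → ℝ, |f t| ≤ M * (1 + ∑ i : Fin n, |t i|) ^ N

/-- An element of `PG_n^h`: a polynomial growth continuous function `f` such that
`f (t • x) / t` converges as `t → 0⁺`, uniformly in `x` on every bounded set. -/
def PolyGrowthH (n : ℕ) (f : (Fin n → ℝ) → ℝ) : Prop :=
  PolyGrowth n f ∧ ∃ fh : (Fin n → ℝ) → ℝ,
    ∀ B : Set (Fin n → ℝ), Bornology.IsBounded B →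
      ∀ ε : ℝ, 0 < ε → ∃ δ : ℝ, 0 < δ ∧
        ∀ t : ℝ, 0 < t → t < δ → ∀ y ∈ B, |f (t • y) / t - fh y| < ε

/-- An element of `H_n`: a continuous positively homogeneous function `ℝⁿ → ℝ`. -/
def PosHomog (n : ℕ) (f : (Fin n → ℝ) → ℝ) : Prop :=
  Continuous f ∧ ∀ (c : ℝ), 0 ≤ c → ∀ t : Fin n → ℝ, f (c • t) = c * f t

section Defs

variable {X : Type*} [Lattice X] [AddCommGroup X] [Module ℝ X]

/-- The order ideal `I_e` generated by `e`. -/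
def idealSet (e : X) : Set X := {x : X | ∃ c : ℝ, 0 ≤ c ∧ |x| ≤ c • e}

/-- The norm `‖x‖_e = inf {c ≥ 0 : |x| ≤ c • e}`. -/
noncomputable def regNorm (e x : X) : ℝ := sInf {c : ℝ | 0 ≤ c ∧ |x| ≤ c • e}

/-- The norm `‖·‖_e` is complete on the set `S`: every `‖·‖_e`-Cauchy sequence in `S`
converges, in `‖·‖_e`, to an element of `S`. -/
def NormComplete (e : X) (S : Set X) : Prop :=
  ∀ u : ℕ → X, (∀ k, u k ∈ S) →
    (∀ ε : ℝ, 0 < ε → ∃ N : ℕ, ∀ p q : ℕ, N ≤ p → N ≤ q → regNorm e (u p - u q) < ε) →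
    ∃ x ∈ S, ∀ ε : ℝ, 0 < ε → ∃ N : ℕ, ∀ p : ℕ, N ≤ p → regNorm e (u p - x) < ε

/-- A uniformly complete vector lattice: `(I_e, ‖·‖_e)` is complete for every `e ≥ 0`. -/
def UniformlyComplete (X : Type*) [Lattice X] [AddCommGroup X] [Module ℝ X] : Prop :=
  ∀ e : X, 0 ≤ e → NormComplete e (idealSet e)

/-- A subset `Z` is uniformly complete as a vector lattice in its own right. -/
def UCSet (Z : Set X) : Prop :=
  ∀ e ∈ Z, 0 ≤ e → NormComplete e (Z ∩ idealSet e)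

/-- A (vector) sublattice: a linear subspace closed under binary suprema. -/
def IsSublatticeSet (Z : Set X) : Prop :=
  (0 ∈ Z) ∧ (∀ a ∈ Z, ∀ b ∈ Z, a + b ∈ Z) ∧ (∀ (c : ℝ), ∀ a ∈ Z, c • a ∈ Z) ∧
  (∀ a ∈ Z, -a ∈ Z) ∧ (∀ a ∈ Z, ∀ b ∈ Z, a ⊔ b ∈ Z) ∧ (∀ a ∈ Z, ∀ b ∈ Z, a ⊓ b ∈ Z)

/-- An order ideal: a linear subspace that is solid. -/
def IsOrderIdealSet (I : Set X) : Prop :=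
  (0 ∈ I) ∧ (∀ a ∈ I, ∀ b ∈ I, a + b ∈ I) ∧ (∀ (c : ℝ), ∀ a ∈ I, c • a ∈ I) ∧
  (∀ a ∈ I, ∀ b : X, |b| ≤ |a| → b ∈ I)

/-- A vector lattice homomorphism defined on the class of functions `ℝⁿ → ℝ`
satisfying the predicate `P` (with pointwise operations), taking values in `X`. -/
def IsLatHom {n : ℕ} (P : ((Fin n → ℝ) → ℝ) → Prop) (Φ : ∀ f, P f → X) : Prop :=
  (∀ (f g : (Fin n → ℝ) → ℝ) (hf : P f) (hg : P g) (hfg : P (f + g)),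
      Φ (f + g) hfg = Φ f hf + Φ g hg) ∧
  (∀ (c : ℝ) (f : (Fin n → ℝ) → ℝ) (hf : P f) (hcf : P (c • f)),
      Φ (c • f) hcf = c • Φ f hf) ∧
  (∀ (f g : (Fin n → ℝ) → ℝ) (hf : P f) (hg : P g) (hfg : P (f ⊔ g)),
      Φ (f ⊔ g) hfg = Φ f hf ⊔ Φ g hg)

end Defs

section MulDefs

variable {X : Type*} [Lattice X] [AddCommGroup X] [Module ℝ X] [Mul X]

/-- A lattice-algebra homomorphism defined on the class of functions `ℝⁿ → ℝ`
satisfying the predicate `P` (with pointwise operations), taking values in `X`. -/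
def IsLatAlgHom {n : ℕ} (P : ((Fin n → ℝ) → ℝ) → Prop) (Ψ : ∀ f, P f → X) : Prop :=
  IsLatHom P Ψ ∧
  (∀ (f g : (Fin n → ℝ) → ℝ) (hf : P f) (hg : P g) (hfg : P (f * g)),
      Ψ (f * g) hfg = Ψ f hf * Ψ g hg)

/-- A sublattice-algebra: a linear subspace that is both a sublattice and a subalgebra. -/
def IsSublatticeAlgebraSet (Z : Set X) : Prop :=
  IsSublatticeSet Z ∧ ∀ a ∈ Z, ∀ b ∈ Z, a * b ∈ Z

/-- The `f`-algebra condition, relativized to a subset. -/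
def IsFAlgebraSet (Z : Set X) : Prop :=
  ∀ a ∈ Z, ∀ b ∈ Z, ∀ z ∈ Z, a ⊓ b = 0 → 0 ≤ z → (z * a) ⊓ b = 0 ∧ (a * z) ⊓ b = 0

/-- An `f`-subalgebra: a sublattice-algebra which is itself an `f`-algebra. -/
def IsFSubalgebra (Z : Set X) : Prop := IsSublatticeAlgebraSet Z ∧ IsFAlgebraSet Z

/-- `powS e m = e^(m+1)`, defined without assuming an identity element. -/
def powS (e : X) : ℕ → X
  | 0 => e
  | m + 1 => powS e m * e

end MulDefs

/-- A map `T : X → A` which is a lattice-algebra homomorphism on a subset `S` of `X`. -/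
def IsLatAlgHomOn {X A : Type*} [Lattice X] [AddCommGroup X] [Module ℝ X] [Mul X]
    [Lattice A] [AddCommGroup A] [Module ℝ A] [Mul A] (S : Set X) (T : X → A) : Prop :=
  (∀ a ∈ S, ∀ b ∈ S, T (a + b) = T a + T b) ∧
  (∀ (c : ℝ), ∀ a ∈ S, T (c • a) = c • T a) ∧
  (∀ a ∈ S, ∀ b ∈ S, T (a ⊔ b) = T a ⊔ T b) ∧
  (∀ a ∈ S, ∀ b ∈ S, T (a * b) = T a * T b)

universe u v

section RelativeUniformClosure

variable {W : Type*} [Lattice W] [AddCommGroup W] [Module ℝ W]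

theorem IsSublatticeSet.of_sup {Z : Set W} [IsOrderedAddMonoid W] (h0 : 0 ∈ Z)
    (hadd : ∀ a ∈ Z, ∀ b ∈ Z, a + b ∈ Z) (hsmul : ∀ c : ℝ, ∀ a ∈ Z, c • a ∈ Z)
    (hsup : ∀ a ∈ Z, ∀ b ∈ Z, a ⊔ b ∈ Z) : IsSublatticeSet Z := by
  have hneg : ∀ a ∈ Z, -a ∈ Z := fun a ha => by simpa using hsmul (-1) a ha
  refine ⟨h0, hadd, hsmul, hneg, hsup, fun a ha b hb => ?_⟩
  have h := hneg _ (hsup _ (hneg a ha) _ (hneg b hb))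
  rwa [neg_sup, neg_neg, neg_neg] at h

namespace IsSublatticeSet

variable {Z : Set W} (hZ : IsSublatticeSet Z) {a b : W}
include hZ

theorem zero_mem : 0 ∈ Z := hZ.1

theorem add_mem (ha : a ∈ Z) (hb : b ∈ Z) : a + b ∈ Z := hZ.2.1 a ha b hb

theorem smul_mem (c : ℝ) (ha : a ∈ Z) : c • a ∈ Z := hZ.2.2.1 c a ha

theorem neg_mem (ha : a ∈ Z) : -a ∈ Z := hZ.2.2.2.1 a ha

theorem sup_mem (ha : a ∈ Z) (hb : b ∈ Z) : a ⊔ b ∈ Z := hZ.2.2.2.2.1 a ha b hb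

theorem inf_mem (ha : a ∈ Z) (hb : b ∈ Z) : a ⊓ b ∈ Z := hZ.2.2.2.2.2 a ha b hb

theorem sub_mem (ha : a ∈ Z) (hb : b ∈ Z) : a - b ∈ Z :=
  sub_eq_add_neg a b ▸ hZ.add_mem ha (hZ.neg_mem hb)

theorem abs_mem (ha : a ∈ Z) : |a| ∈ Z := hZ.sup_mem ha (hZ.neg_mem ha)

end IsSublatticeSet

/-- The set of all relatively uniform limits of elements of `S`, with regulators in `S`. -/
def ruClosure (S : Set W) : Set W :=
  {y | ∃ e ∈ S, ∀ ε : ℝ, 0 < ε → ∃ u ∈ S, |u - y| ≤ ε • e}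

theorem ruClosure_mono {S S' : Set W} (h : S ⊆ S') : ruClosure S ⊆ ruClosure S' := by
  rintro y ⟨e, he, hy⟩
  refine ⟨e, h he, fun ε hε => ?_⟩
  obtain ⟨u, hu, hle⟩ := hy ε hε
  exact ⟨u, h hu, hle⟩

variable [IsOrderedAddMonoid W] [PosSMulMono ℝ W]

omit [PosSMulMono ℝ W] in
theorem subset_ruClosure {S : Set W} (h0 : 0 ∈ S) : S ⊆ ruClosure S :=
  fun y hy => ⟨0, h0, fun ε _ => ⟨y, hy, by simp⟩⟩

theorem smul_le_smul_of_le {c d : ℝ} {e : W} (h : c ≤ d) (he : 0 ≤ e) : c • e ≤ d • e := by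
  have := smul_nonneg (sub_nonneg.2 h) he
  rwa [sub_smul, sub_nonneg] at this

omit [IsOrderedAddMonoid W] in
theorem abs_smul_le_abs_smul_abs (c : ℝ) (x : W) : |c • x| ≤ |c| • |x| := by
  rcases le_total 0 c with hc | hc
  · rw [abs_of_nonneg hc]
    refine abs_le'.2 ⟨smul_le_smul_of_nonneg_left (le_abs_self x) hc, ?_⟩
    rw [← smul_neg]
    exact smul_le_smul_of_nonneg_left (neg_le_abs x) hc
  · rw [abs_of_nonpos hc]
    have hc' := neg_nonneg.2 hc
    refine abs_le'.2 ⟨?_, ?_⟩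
    · rw [← neg_smul_neg]
      exact smul_le_smul_of_nonneg_left (neg_le_abs x) hc'
    · rw [← neg_smul]
      exact smul_le_smul_of_nonneg_left (le_abs_self x) hc'

omit [Module ℝ W] [PosSMulMono ℝ W] in
theorem abs_sub_le_add_abs_sub (a b c : W) : |a - c| ≤ |a - b| + |b - c| := by
  simpa using abs_add_le (a - b) (b - c)

omit [Module ℝ W] [PosSMulMono ℝ W] in
theorem abs_sup_sub_sup_le_add (a b c d : W) : |a ⊔ b - c ⊔ d| ≤ |a - c| + |b - d| := by
  refine (abs_sub_le_add_abs_sub _ (c ⊔ b) _).trans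
    (add_le_add (abs_sup_sub_sup_le_abs a c b) ?_)
  rw [sup_comm c b, sup_comm c d]
  exact abs_sup_sub_sup_le_abs b d c

theorem IsSublatticeSet.ruClosure {S : Set W} (hS : IsSublatticeSet S) :
    IsSublatticeSet (ruClosure S) := by
  refine .of_sup (subset_ruClosure hS.zero_mem hS.zero_mem) ?_ ?_ ?_
  · rintro y ⟨e, he, hy⟩ z ⟨f, hf, hz⟩
    refine ⟨e + f, hS.add_mem he hf, fun ε hε => ?_⟩
    obtain ⟨u, hu, hule⟩ := hy ε hε
    obtain ⟨v, hv, hvle⟩ := hz ε hε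
    refine ⟨u + v, hS.add_mem hu hv, ?_⟩
    rw [add_sub_add_comm, smul_add]
    exact (abs_add_le _ _).trans (add_le_add hule hvle)
  · rintro c y ⟨e, he, hy⟩
    refine ⟨|c| • e, hS.smul_mem _ he, fun ε hε => ?_⟩
    obtain ⟨u, hu, hule⟩ := hy ε hε
    refine ⟨c • u, hS.smul_mem _ hu, ?_⟩
    rw [← smul_sub, smul_comm ε]
    exact (abs_smul_le_abs_smul_abs _ _).trans
      (smul_le_smul_of_nonneg_left hule (abs_nonneg c))
  · rintro y ⟨e, he, hy⟩ z ⟨f, hf, hz⟩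
    refine ⟨e + f, hS.add_mem he hf, fun ε hε => ?_⟩
    obtain ⟨u, hu, hule⟩ := hy ε hε
    obtain ⟨v, hv, hvle⟩ := hz ε hε
    refine ⟨u ⊔ v, hS.sup_mem hu hv, ?_⟩
    rw [smul_add]
    exact (abs_sup_sub_sup_le_add _ _ _ _).trans (add_le_add hule hvle)

theorem eq_zero_of_abs_le_smul
    (harch : ∀ a b : W, 0 ≤ a → 0 ≤ b → (∀ k : ℕ, k • a ≤ b) → a = 0) {a b : W}
    (h : ∀ ε : ℝ, 0 < ε → |a| ≤ ε • b) : a = 0 := by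
  have hb : 0 ≤ b := (abs_nonneg a).trans (by simpa using h 1 one_pos)
  have h0 : |a| = 0 := by
    refine harch _ b (abs_nonneg a) hb fun k => ?_
    rcases Nat.eq_zero_or_pos k with rfl | hk
    · simpa using hb
    · have hk' : (0 : ℝ) < k := Nat.cast_pos.2 hk
      have := smul_le_smul_of_nonneg_left (h (k : ℝ)⁻¹ (inv_pos.2 hk')) hk'.le
      rwa [smul_inv_smul₀ hk'.ne', Nat.cast_smul_eq_nsmul] at this
  exact le_antisymm (h0 ▸ le_abs_self a) (neg_nonpos.1 (h0 ▸ neg_le_abs a))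

omit [IsOrderedAddMonoid W] [PosSMulMono ℝ W] in
theorem regNorm_le {e x : W} {c : ℝ} (hc : 0 ≤ c) (h : |x| ≤ c • e) : regNorm e x ≤ c :=
  csInf_le ⟨0, fun _ hd => hd.1⟩ ⟨hc, h⟩

theorem abs_le_smul_of_regNorm_lt {e x : W} {ε : ℝ} (he : 0 ≤ e) (hx : x ∈ idealSet e)
    (h : regNorm e x < ε) : |x| ≤ ε • e := by
  obtain ⟨c, ⟨_, hc⟩, hlt⟩ := exists_lt_of_csInf_lt hx h
  exact hc.trans (smul_le_smul_of_le hlt.le he)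

omit [PosSMulMono ℝ W] in
theorem sub_mem_idealSet {e x y : W} (hx : x ∈ idealSet e) (hy : y ∈ idealSet e) :
    x - y ∈ idealSet e := by
  obtain ⟨c, hc, hxc⟩ := hx
  obtain ⟨d, hd, hyd⟩ := hy
  refine ⟨c + d, add_nonneg hc hd, ?_⟩
  rw [add_smul, sub_eq_add_neg]
  exact (abs_add_le _ _).trans (add_le_add hxc (by rwa [abs_neg]))

theorem NormComplete.exists_limit {S : Set W} (hS : IsSublatticeSet S) {e : W} (he : 0 ≤ e)
    (hc : NormComplete e (S ∩ idealSet e)) {u : ℕ → W} (hu : ∀ n, u n ∈ S)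
    (hcauchy : ∀ p q : ℕ, |u p - u q| ≤ (1 / ((p : ℝ) + 1) + 1 / ((q : ℝ) + 1)) • e) :
    ∃ x ∈ S, ∀ ε : ℝ, 0 < ε → ∃ N : ℕ, ∀ p : ℕ, N ≤ p → |u p - x| ≤ ε • e := by
  have hmem : ∀ k, u k - u 0 ∈ S ∩ idealSet e := fun k =>
    ⟨hS.sub_mem (hu k) (hu 0), _, by positivity, hcauchy k 0⟩
  obtain ⟨x, ⟨hxS, hxe⟩, hx⟩ := hc (fun k => u k - u 0) hmem fun ε hε => by
    obtain ⟨N, hN⟩ := exists_nat_one_div_lt (half_pos hε)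
    refine ⟨N, fun p q hp hq => ?_⟩
    have hp' := (Nat.one_div_le_one_div (α := ℝ) hp).trans_lt hN
    have hq' := (Nat.one_div_le_one_div (α := ℝ) hq).trans_lt hN
    rw [sub_sub_sub_cancel_right]
    exact (regNorm_le (by positivity) (hcauchy p q)).trans_lt (by linarith)
  refine ⟨x + u 0, hS.add_mem hxS (hu 0), fun ε hε => ?_⟩
  obtain ⟨N, hN⟩ := hx ε hε
  refine ⟨N, fun p hp => ?_⟩
  rw [add_comm x, ← sub_sub]
  exact abs_le_smul_of_regNorm_lt he (sub_mem_idealSet (hmem p).2 hxe) (hN p hp)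

omit [PosSMulMono ℝ W] in
theorem exists_seq_of_mem_ruClosure {S : Set W} {y e : W}
    (h : ∀ ε : ℝ, 0 < ε → ∃ u ∈ S, |u - y| ≤ ε • e) :
    ∃ u : ℕ → W, (∀ n, u n ∈ S) ∧ (∀ n : ℕ, |u n - y| ≤ (1 / ((n : ℝ) + 1)) • e) ∧
      ∀ p q : ℕ, |u p - u q| ≤ (1 / ((p : ℝ) + 1) + 1 / ((q : ℝ) + 1)) • e := by
  choose u hu hle using fun n : ℕ => h (1 / ((n : ℝ) + 1)) (by positivity)
  refine ⟨u, hu, hle, fun p q => ?_⟩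
  rw [add_smul]
  exact (abs_sub_le_add_abs_sub _ y _).trans
    (add_le_add (hle p) (abs_sub_comm y (u q) ▸ hle q))

omit [PosSMulMono ℝ W] in
theorem nonneg_of_regulator {S : Set W} {y e : W}
    (h : ∀ ε : ℝ, 0 < ε → ∃ u ∈ S, |u - y| ≤ ε • e) : 0 ≤ e := by
  obtain ⟨u, -, hu⟩ := h 1 one_pos
  exact (abs_nonneg _).trans (by simpa using hu)

theorem UCSet.ruClosure_subset
    (harch : ∀ a b : W, 0 ≤ a → 0 ≤ b → (∀ k : ℕ, k • a ≤ b) → a = 0) {Z : Set W}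
    (hZ : IsSublatticeSet Z) (huc : UCSet Z) : ruClosure Z ⊆ Z := by
  rintro y ⟨e, he, hy⟩
  have he0 := nonneg_of_regulator hy
  obtain ⟨u, hu, huy, hcauchy⟩ := exists_seq_of_mem_ruClosure hy
  obtain ⟨x, hxZ, hx⟩ := (huc e he he0).exists_limit hZ he0 hu hcauchy
  suffices h : y - x = 0 by rwa [sub_eq_zero.1 h]
  refine eq_zero_of_abs_le_smul harch (b := e) fun ε hε => ?_
  obtain ⟨N, hN⟩ := hx (ε / 2) (half_pos hε)
  obtain ⟨M, hM⟩ := exists_nat_one_div_lt (half_pos hε)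
  have h1 : |y - u (max N M)| ≤ (ε / 2) • e := by
    rw [abs_sub_comm]
    exact (huy _).trans (smul_le_smul_of_le
      ((Nat.one_div_le_one_div (le_max_right N M)).trans hM.le) he0)
  have h2 := add_le_add h1 (hN (max N M) (le_max_left N M))
  rw [← add_smul, add_halves] at h2
  exact (abs_sub_le_add_abs_sub _ _ _).trans h2

theorem UniformlyComplete.ucSet_of_ruClosure_subset (huc : UniformlyComplete W) {Z : Set W}
    (hcl : ruClosure Z ⊆ Z) : UCSet Z := by
  intro e he he0 u hu hcauchy
  obtain ⟨x, hxe, hx⟩ := huc e he0 u (fun k => (hu k).2) hcauchy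
  refine ⟨x, ⟨hcl ⟨e, he, fun ε hε => ?_⟩, hxe⟩, hx⟩
  obtain ⟨N, hN⟩ := hx ε hε
  exact ⟨u N, (hu N).1,
    abs_le_smul_of_regNorm_lt he0 (sub_mem_idealSet (hu N).2 hxe) (hN N le_rfl)⟩

end RelativeUniformClosure

section UniformCompletion

variable {W : Type*} [Lattice W] [AddCommGroup W] [Module ℝ W]

/-- The intersection of all uniformly complete sublattices containing `X`. -/
def uniformHull (X : Set W) : Set W :=
  ⋂₀ {Z : Set W | IsSublatticeSet Z ∧ X ⊆ Z ∧ UCSet Z}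

theorem subset_uniformHull (X : Set W) : X ⊆ uniformHull X :=
  Set.subset_sInter fun _ hZ => hZ.2.1

variable [IsOrderedAddMonoid W] [PosSMulMono ℝ W]

omit [PosSMulMono ℝ W] in
theorem isSublatticeSet_uniformHull (X : Set W) : IsSublatticeSet (uniformHull X) :=
  .of_sup (fun _ hZ => hZ.1.zero_mem)
    (fun _ ha _ hb Z hZ => hZ.1.add_mem (ha Z hZ) (hb Z hZ))
    (fun c _ ha Z hZ => hZ.1.smul_mem c (ha Z hZ))
    (fun _ ha _ hb Z hZ => hZ.1.sup_mem (ha Z hZ) (hb Z hZ))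

theorem ruClosure_uniformHull_subset
    (harch : ∀ a b : W, 0 ≤ a → 0 ≤ b → (∀ k : ℕ, k • a ≤ b) → a = 0) (X : Set W) :
    ruClosure (uniformHull X) ⊆ uniformHull X := fun _ hy _ hZ =>
  hZ.2.2.ruClosure_subset harch hZ.1 (ruClosure_mono (Set.sInter_subset_of_mem hZ) hy)

theorem uniformHull_subset (huc : UniformlyComplete W) {X Z : Set W} (hZ : IsSublatticeSet Z)
    (hXZ : X ⊆ Z) (hcl : ruClosure Z ⊆ Z) : uniformHull X ⊆ Z :=
  Set.sInter_subset_of_mem ⟨hZ, hXZ, huc.ucSet_of_ruClosure_subset hcl⟩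

end UniformCompletion

section LatticeOrderedAlgebra

variable {W : Type*} [Lattice W] [NonUnitalRing W] [Module ℝ W] [IsOrderedAddMonoid W]
  [PosSMulMono ℝ W]

theorem abs_mul_le_mul_abs (hmul : ∀ a b : W, 0 ≤ a → 0 ≤ b → 0 ≤ a * b) (a b : W) :
    |a * b| ≤ |a| * |b| := by
  have key : ∀ a b : W, a * b ≤ |a| * |b| := fun a b => by
    have h := add_nonneg
      (hmul (|a| - a) (|b| + b) (sub_nonneg.2 (le_abs_self a))
        (neg_le_iff_add_nonneg.1 (neg_le_abs b)))
      (hmul (|a| + a) (|b| - b) (neg_le_iff_add_nonneg.1 (neg_le_abs a))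
        (sub_nonneg.2 (le_abs_self b)))
    have h2 : (|a| - a) * (|b| + b) + (|a| + a) * (|b| - b) =
        (2 : ℝ) • (|a| * |b| - a * b) := by
      rw [two_smul]
      noncomm_ring
    rw [h2] at h
    have h3 := smul_nonneg (by norm_num : (0 : ℝ) ≤ 2⁻¹) h
    rw [inv_smul_smul₀ two_ne_zero] at h3
    exact sub_nonneg.1 h3
  refine abs_le'.2 ⟨key a b, ?_⟩
  simpa using key (-a) b

omit [Module ℝ W] [PosSMulMono ℝ W] in
theorem mul_le_mul_of_mul_nonneg (hmul : ∀ a b : W, 0 ≤ a → 0 ≤ b → 0 ≤ a * b) {a b c d : W}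
    (hab : a ≤ b) (hcd : c ≤ d) (hc : 0 ≤ c) (hb : 0 ≤ b) : a * c ≤ b * d := by
  have h := add_nonneg (hmul _ _ (sub_nonneg.2 hab) hc) (hmul _ _ hb (sub_nonneg.2 hcd))
  rw [sub_mul, mul_sub, add_comm, sub_add_sub_cancel] at h
  exact sub_nonneg.1 h

theorem IsSublatticeAlgebraSet.ruClosure [IsScalarTower ℝ W W] [SMulCommClass ℝ W W]
    (hmul : ∀ a b : W, 0 ≤ a → 0 ≤ b → 0 ≤ a * b) {S : Set W}
    (hS : IsSublatticeAlgebraSet S) : IsSublatticeAlgebraSet (ruClosure S) := by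
  refine ⟨hS.1.ruClosure, ?_⟩
  rintro y ⟨e, he, hy⟩ z ⟨f, hf, hz⟩
  have he0 := nonneg_of_regulator hy
  have hf0 := nonneg_of_regulator hz
  obtain ⟨u₀, hu₀, hu₀y⟩ := hy 1 one_pos
  obtain ⟨v₀, hv₀, hv₀z⟩ := hz 1 one_pos
  rw [one_smul] at hu₀y hv₀z
  have hyle : |y| ≤ e + |u₀| := by
    have h := abs_sub_le_add_abs_sub y u₀ 0
    rw [sub_zero, sub_zero, abs_sub_comm] at h
    exact h.trans (by gcongr)
  have hzle : |z| ≤ f + |v₀| := by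
    have h := abs_sub_le_add_abs_sub z v₀ 0
    rw [sub_zero, sub_zero, abs_sub_comm] at h
    exact h.trans (by gcongr)
  refine ⟨e * (f + (f + |v₀|)) + (e + |u₀|) * f, hS.1.add_mem
    (hS.2 _ he _ (hS.1.add_mem hf (hS.1.add_mem hf (hS.1.abs_mem hv₀))))
    (hS.2 _ (hS.1.add_mem he (hS.1.abs_mem hu₀)) _ hf), fun ε hε => ?_⟩
  obtain ⟨u, hu, huy⟩ := hy ε hε
  obtain ⟨v, hv, hvz⟩ := hz (min ε 1) (lt_min hε one_pos)
  have hvz1 : |v - z| ≤ f := hvz.trans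
    ((smul_le_smul_of_le (min_le_right ε 1) hf0).trans_eq (one_smul ℝ f))
  have hvzε : |v - z| ≤ ε • f := hvz.trans (smul_le_smul_of_le (min_le_left ε 1) hf0)
  have hvle : |v| ≤ f + (f + |v₀|) := by
    have h := abs_sub_le_add_abs_sub v z 0
    rw [sub_zero, sub_zero] at h
    exact h.trans (add_le_add hvz1 hzle)
  refine ⟨u * v, hS.2 u hu v hv, ?_⟩
  have heq : u * v - y * z = (u - y) * v + y * (v - z) := by noncomm_ring
  rw [heq, smul_add, ← smul_mul_assoc, ← mul_smul_comm]
  refine (abs_add_le _ _).trans (add_le_add ?_ ?_)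
  · exact (abs_mul_le_mul_abs hmul _ _).trans
      (mul_le_mul_of_mul_nonneg hmul huy hvle (abs_nonneg _) (smul_nonneg hε.le he0))
  · exact (abs_mul_le_mul_abs hmul _ _).trans
      (mul_le_mul_of_mul_nonneg hmul hyle hvzε (abs_nonneg _)
        (add_nonneg he0 (abs_nonneg _)))

omit [IsOrderedAddMonoid W] [PosSMulMono ℝ W] in
theorem IsSublatticeAlgebraSet.sUnion {c : Set (Set W)} (hne : c.Nonempty)
    (hchain : IsChain (· ⊆ ·) c) (hc : ∀ S ∈ c, IsSublatticeAlgebraSet S) :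
    IsSublatticeAlgebraSet (⋃₀ c) := by
  have pair : ∀ a ∈ ⋃₀ c, ∀ b ∈ ⋃₀ c, ∃ S ∈ c, a ∈ S ∧ b ∈ S := by
    rintro a ⟨S, hS, ha⟩ b ⟨S', hS', hb⟩
    rcases hchain.total hS hS' with h | h
    · exact ⟨S', hS', h ha, hb⟩
    · exact ⟨S, hS, ha, h hb⟩
  obtain ⟨S₀, hS₀⟩ := hne
  refine ⟨⟨⟨S₀, hS₀, (hc S₀ hS₀).1.zero_mem⟩, fun a ha b hb => ?_, ?_, ?_, fun a ha b hb => ?_,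
    fun a ha b hb => ?_⟩, fun a ha b hb => ?_⟩
  · obtain ⟨S, hS, haS, hbS⟩ := pair a ha b hb
    exact ⟨S, hS, (hc S hS).1.add_mem haS hbS⟩
  · rintro r a ⟨S, hS, haS⟩
    exact ⟨S, hS, (hc S hS).1.smul_mem r haS⟩
  · rintro a ⟨S, hS, haS⟩
    exact ⟨S, hS, (hc S hS).1.neg_mem haS⟩
  · obtain ⟨S, hS, haS, hbS⟩ := pair a ha b hb
    exact ⟨S, hS, (hc S hS).1.sup_mem haS hbS⟩
  · obtain ⟨S, hS, haS, hbS⟩ := pair a ha b hb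
    exact ⟨S, hS, (hc S hS).1.inf_mem haS hbS⟩
  · obtain ⟨S, hS, haS, hbS⟩ := pair a ha b hb
    exact ⟨S, hS, (hc S hS).2 a haS b hbS⟩

end LatticeOrderedAlgebra

section Extension

variable {Y A : Type*} [Lattice Y] [NonUnitalRing Y] [Module ℝ Y] [IsOrderedAddMonoid Y]
  [PosSMulMono ℝ Y] [Lattice A] [NonUnitalRing A] [Module ℝ A] [IsOrderedAddMonoid A]
  [PosSMulMono ℝ A]

/-- A sublattice of `Y × A` that is the graph of a partially defined map. -/
def IsGraph (G : Set (Y × A)) : Prop :=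
  IsSublatticeSet G ∧ ∀ a : A, ((0 : Y), a) ∈ G → a = 0

namespace IsGraph

variable {G : Set (Y × A)} (hG : IsGraph G)
include hG

omit [IsOrderedAddMonoid Y] [PosSMulMono ℝ Y] [IsOrderedAddMonoid A] [PosSMulMono ℝ A] in
theorem eq_of_mem {y : Y} {a b : A} (ha : (y, a) ∈ G) (hb : (y, b) ∈ G) : a = b := by
  have h := hG.1.sub_mem ha hb
  rw [Prod.mk_sub_mk, sub_self] at h
  exact sub_eq_zero.1 (hG.2 _ h)

omit [IsOrderedAddMonoid Y] [PosSMulMono ℝ Y] [IsOrderedAddMonoid A] [PosSMulMono ℝ A] in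
theorem snd_nonneg {p : Y × A} (hp : p ∈ G) (h : 0 ≤ p.1) : 0 ≤ p.2 := by
  have h1 := hG.1.inf_mem hp hG.1.zero_mem
  have h2 : p ⊓ 0 = ((0 : Y), p.2 ⊓ 0) := Prod.ext (inf_eq_right.2 h) rfl
  rw [h2] at h1
  exact inf_eq_right.1 (hG.2 _ h1)

omit [PosSMulMono ℝ Y] [PosSMulMono ℝ A] in
theorem abs_snd_le {p q : Y × A} (hp : p ∈ G) (hq : q ∈ G) (h : |p.1| ≤ q.1) : |p.2| ≤ q.2 :=
  sub_nonneg.1 (hG.snd_nonneg (hG.1.sub_mem hq (hG.1.abs_mem hp)) (sub_nonneg.2 h))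

theorem ruClosure (harchA : ∀ a b : A, 0 ≤ a → 0 ≤ b → (∀ k : ℕ, k • a ≤ b) → a = 0) :
    IsGraph (ruClosure G) := by
  refine ⟨hG.1.ruClosure, fun a ⟨e, he, ha⟩ => ?_⟩
  refine eq_zero_of_abs_le_smul harchA (b := e.2) fun ε hε => ?_
  obtain ⟨u, hu, hle⟩ := ha (ε / 2) (half_pos hε)
  have h1 : |u.1 - 0| ≤ (ε / 2) • e.1 := hle.1
  have h2 : |u.2 - a| ≤ (ε / 2) • e.2 := hle.2
  rw [sub_zero] at h1
  have h3 : |u.2| ≤ (ε / 2) • e.2 := hG.abs_snd_le hu (hG.1.smul_mem (ε / 2) he) h1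
  have h4 := abs_sub_le_add_abs_sub a u.2 0
  rw [sub_zero, sub_zero, abs_sub_comm] at h4
  have h5 := h4.trans (add_le_add h2 h3)
  rwa [← add_smul, add_halves] at h5

theorem ruClosure_fst_image_subset (hucA : UniformlyComplete A) (hcl : _root_.ruClosure G ⊆ G) :
    _root_.ruClosure (Prod.fst '' G) ⊆ Prod.fst '' G := by
  rintro y ⟨_, ⟨e, he, rfl⟩, hy⟩
  obtain ⟨u, hu, huy, hcauchy⟩ := exists_seq_of_mem_ruClosure hy
  choose g hg hgu using hu
  obtain rfl : (fun n => (g n).1) = u := funext hgu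
  have he0 : 0 ≤ e.2 := hG.snd_nonneg he (nonneg_of_regulator hy)
  have huniv : IsSublatticeSet (Set.univ : Set A) := by simp [IsSublatticeSet]
  obtain ⟨a, -, ha⟩ := NormComplete.exists_limit huniv he0
    (by rw [Set.univ_inter]; exact hucA e.2 he0) (u := fun n => (g n).2) (fun _ => trivial)
    fun p q => hG.abs_snd_le (hG.1.sub_mem (hg p) (hg q)) (hG.1.smul_mem _ he) (hcauchy p q)
  refine ⟨(y, a), hcl ⟨e, he, fun ε hε => ?_⟩, rfl⟩
  obtain ⟨N, hN⟩ := ha ε hε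
  obtain ⟨M, hM⟩ := exists_nat_one_div_lt hε
  refine ⟨g (max N M), hg _, ?_, hN _ (le_max_left N M)⟩
  exact (huy _).trans (smul_le_smul_of_le
    ((Nat.one_div_le_one_div (le_max_right N M)).trans hM.le) (nonneg_of_regulator hy))

end IsGraph

omit [PosSMulMono ℝ Y] [IsOrderedAddMonoid A] [PosSMulMono ℝ A] in
theorem IsSublatticeSet.fst_image {G : Set (Y × A)} (hG : IsSublatticeSet G) :
    IsSublatticeSet (Prod.fst '' G) := by
  refine .of_sup ⟨0, hG.zero_mem, rfl⟩ ?_ ?_ ?_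
  · rintro _ ⟨p, hp, rfl⟩ _ ⟨q, hq, rfl⟩
    exact ⟨p + q, hG.add_mem hp hq, rfl⟩
  · rintro c _ ⟨p, hp, rfl⟩
    exact ⟨c • p, hG.smul_mem c hp, rfl⟩
  · rintro _ ⟨p, hp, rfl⟩ _ ⟨q, hq, rfl⟩
    exact ⟨p ⊔ q, hG.sup_mem hp hq, rfl⟩

omit [PosSMulMono ℝ Y] [PosSMulMono ℝ A] in
theorem IsLatAlgHomOn.isSublatticeAlgebraSet_graph {X : Set Y} (hX : IsSublatticeAlgebraSet X)
    {T : Y → A} (hT : IsLatAlgHomOn X T) :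
    IsSublatticeAlgebraSet ((fun x => (x, T x)) '' X) := by
  refine ⟨.of_sup ⟨0, hX.1.zero_mem, Prod.ext rfl ?_⟩ ?_ ?_ ?_, ?_⟩
  · simpa using hT.2.1 0 0 hX.1.zero_mem
  · rintro _ ⟨a, ha, rfl⟩ _ ⟨b, hb, rfl⟩
    exact ⟨a + b, hX.1.add_mem ha hb, Prod.ext rfl (hT.1 a ha b hb)⟩
  · rintro c _ ⟨a, ha, rfl⟩
    exact ⟨c • a, hX.1.smul_mem c ha, Prod.ext rfl (hT.2.1 c a ha)⟩
  · rintro _ ⟨a, ha, rfl⟩ _ ⟨b, hb, rfl⟩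
    exact ⟨a ⊔ b, hX.1.sup_mem ha hb, Prod.ext rfl (hT.2.2.1 a ha b hb)⟩
  · rintro _ ⟨a, ha, rfl⟩ _ ⟨b, hb, rfl⟩
    exact ⟨a * b, hX.2 a ha b hb, Prod.ext rfl (hT.2.2.2 a ha b hb)⟩

variable [IsScalarTower ℝ Y Y] [SMulCommClass ℝ Y Y] [IsScalarTower ℝ A A] [SMulCommClass ℝ A A]

/-- By Zorn's lemma, the graph of a lattice-algebra homomorphism on `X` extends to the graph of a
lattice-algebra homomorphism on the uniform hull of `X`. -/
theorem exists_graph_extension (hmulY : ∀ a b : Y, 0 ≤ a → 0 ≤ b → 0 ≤ a * b)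
    (harchY : ∀ a b : Y, 0 ≤ a → 0 ≤ b → (∀ k : ℕ, k • a ≤ b) → a = 0)
    (hucY : UniformlyComplete Y) (hmulA : ∀ a b : A, 0 ≤ a → 0 ≤ b → 0 ≤ a * b)
    (harchA : ∀ a b : A, 0 ≤ a → 0 ≤ b → (∀ k : ℕ, k • a ≤ b) → a = 0)
    (hucA : UniformlyComplete A) {X : Set Y} (hX : IsSublatticeAlgebraSet X) {T : Y → A}
    (hT : IsLatAlgHomOn X T) :
    ∃ G : Set (Y × A), IsSublatticeAlgebraSet G ∧ IsGraph G ∧ (∀ x ∈ X, (x, T x) ∈ G) ∧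
      Prod.fst '' G = uniformHull X := by
  have hT0 : T 0 = 0 := by simpa using hT.2.1 0 0 hX.1.zero_mem
  obtain ⟨G, hle, hmax⟩ := zorn_subset_nonempty
    {G : Set (Y × A) | IsSublatticeAlgebraSet G ∧ (∀ a : A, ((0 : Y), a) ∈ G → a = 0) ∧
      ∀ p ∈ G, p.1 ∈ uniformHull X}
    (fun c hc hchain hne => ⟨⋃₀ c, ⟨.sUnion hne hchain fun S hS => (hc hS).1,
      fun a ⟨S, hS, ha⟩ => (hc hS).2.1 a ha, fun p ⟨S, hS, hp⟩ => (hc hS).2.2 p hp⟩,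
      fun S hS => Set.subset_sUnion_of_mem hS⟩)
    ((fun x => (x, T x)) '' X) ⟨hT.isSublatticeAlgebraSet_graph hX, by
      rintro a ⟨x, -, hxa⟩
      obtain rfl : x = 0 := congrArg Prod.fst hxa
      exact (congrArg Prod.snd hxa).symm.trans hT0, by
      rintro _ ⟨x, hx, rfl⟩
      exact subset_uniformHull X hx⟩
  obtain ⟨hGalg, hG0, hGX⟩ := hmax.prop
  have hG : IsGraph G := ⟨hGalg.1, hG0⟩
  have hcl : ruClosure G ⊆ G := by
    refine hmax.le_of_ge ⟨hGalg.ruClosure fun a b ha hb =>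
      Prod.le_def.2 ⟨hmulY _ _ (Prod.le_def.1 ha).1 (Prod.le_def.1 hb).1,
        hmulA _ _ (Prod.le_def.1 ha).2 (Prod.le_def.1 hb).2⟩, (hG.ruClosure harchA).2, ?_⟩
      (subset_ruClosure hGalg.1.zero_mem)
    rintro y ⟨e, he, hy⟩
    refine ruClosure_uniformHull_subset harchY X ⟨e.1, hGX e he, fun ε hε => ?_⟩
    obtain ⟨u, hu, hule⟩ := hy ε hε
    exact ⟨u.1, hGX u hu, hule.1⟩
  refine ⟨G, hGalg, hG, fun x hx => hle ⟨x, hx, rfl⟩, ?_⟩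
  refine Set.Subset.antisymm (by rintro _ ⟨p, hp, rfl⟩; exact hGX p hp) ?_
  exact uniformHull_subset hucY hGalg.1.fst_image (fun x hx => ⟨_, hle ⟨x, hx, rfl⟩, rfl⟩)
    (hG.ruClosure_fst_image_subset hucA hcl)

omit [IsScalarTower ℝ Y Y] [SMulCommClass ℝ Y Y] [IsScalarTower ℝ A A] [SMulCommClass ℝ A A] in
omit [IsOrderedAddMonoid Y] [PosSMulMono ℝ Y] [IsOrderedAddMonoid A] [PosSMulMono ℝ A] in
theorem IsLatAlgHomOn.abs_sub_le {Z : Set Y} (hZ : IsSublatticeSet Z) {T : Y → A}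
    (hT : IsLatAlgHomOn Z T) {u y e : Y} (hu : u ∈ Z) (hy : y ∈ Z) (he : e ∈ Z)
    (h : |u - y| ≤ e) : |T u - T y| ≤ T e := by
  have hneg : ∀ a ∈ Z, T (-a) = -T a := fun a ha => by simpa using hT.2.1 (-1) a ha
  have hsub : T (u - y) = T u - T y := by
    rw [sub_eq_add_neg, hT.1 u hu _ (hZ.neg_mem hy), hneg y hy, sub_eq_add_neg]
  have hmem := hZ.sub_mem hu hy
  have habs : T |u - y| = |T u - T y| := by
    rw [abs, hT.2.2.1 _ hmem _ (hZ.neg_mem hmem), hneg _ hmem, hsub, abs]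
  rw [← habs, ← sup_eq_right, ← hT.2.2.1 _ (hZ.abs_mem hmem) e he, sup_eq_right.2 h]

omit [IsScalarTower ℝ Y Y] [SMulCommClass ℝ Y Y] [IsScalarTower ℝ A A] [SMulCommClass ℝ A A] in
theorem IsLatAlgHomOn.eq_on_uniformHull
    (harchY : ∀ a b : Y, 0 ≤ a → 0 ≤ b → (∀ k : ℕ, k • a ≤ b) → a = 0)
    (hucY : UniformlyComplete Y)
    (harchA : ∀ a b : A, 0 ≤ a → 0 ≤ b → (∀ k : ℕ, k • a ≤ b) → a = 0) {X : Set Y}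
    {T₁ T₂ : Y → A} (h₁ : IsLatAlgHomOn (uniformHull X) T₁)
    (h₂ : IsLatAlgHomOn (uniformHull X) T₂) (hX : ∀ a ∈ X, T₁ a = T₂ a) :
    ∀ a ∈ uniformHull X, T₁ a = T₂ a := by
  have hull := isSublatticeSet_uniformHull X
  suffices h : uniformHull X ⊆ {a | a ∈ uniformHull X ∧ T₁ a = T₂ a} from fun a ha => (h ha).2
  refine uniformHull_subset hucY (.of_sup ⟨hull.zero_mem, ?_⟩ ?_ ?_ ?_)
    (fun a ha => ⟨subset_uniformHull X ha, hX a ha⟩) ?_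
  · have e₁ := h₁.2.1 0 0 hull.zero_mem
    have e₂ := h₂.2.1 0 0 hull.zero_mem
    simp only [zero_smul] at e₁ e₂
    rw [e₁, e₂]
  · rintro a ⟨ha, hae⟩ b ⟨hb, hbe⟩
    exact ⟨hull.add_mem ha hb, by rw [h₁.1 a ha b hb, h₂.1 a ha b hb, hae, hbe]⟩
  · rintro c a ⟨ha, hae⟩
    exact ⟨hull.smul_mem c ha, by rw [h₁.2.1 c a ha, h₂.2.1 c a ha, hae]⟩
  · rintro a ⟨ha, hae⟩ b ⟨hb, hbe⟩
    exact ⟨hull.sup_mem ha hb, by rw [h₁.2.2.1 a ha b hb, h₂.2.2.1 a ha b hb, hae, hbe]⟩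
  · intro y hy
    have hyX := ruClosure_uniformHull_subset harchY X (ruClosure_mono (fun _ h => h.1) hy)
    obtain ⟨e, ⟨he, hee⟩, hy⟩ := hy
    refine ⟨hyX, sub_eq_zero.1 (eq_zero_of_abs_le_smul harchA (b := T₁ e) fun ε hε => ?_)⟩
    obtain ⟨u, ⟨hu, hue⟩, hle⟩ := hy (ε / 2) (half_pos hε)
    have hm := hull.smul_mem (ε / 2) he
    have b₁ := h₁.abs_sub_le hull hu hyX hm hle
    have b₂ := h₂.abs_sub_le hull hu hyX hm hle
    rw [h₁.2.1 _ _ he, abs_sub_comm] at b₁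
    rw [h₂.2.1 _ _ he, ← hee, ← hue] at b₂
    have b := (abs_sub_le_add_abs_sub _ _ _).trans (add_le_add b₁ b₂)
    rwa [← add_smul, add_halves] at b

end Extension

/-- Lemma 2.9 / `lem:ucfalg`: the uniform completion of a
sublattice-algebra of a uniformly complete `f`-algebra is again a sublattice-algebra,
and lattice-algebra homomorphisms into uniformly complete `f`-algebras extend uniquely. -/
theorem stmt_4 {Y : Type u} [Lattice Y] [NonUnitalRing Y] [Module ℝ Y]
    [CovariantClass Y Y (· + ·) (· ≤ ·)] [IsScalarTower ℝ Y Y] [SMulCommClass ℝ Y Y]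
    (hsmulposY : ∀ (c : ℝ) (a : Y), 0 ≤ c → 0 ≤ a → 0 ≤ c • a)
    (hmulposY : ∀ a b : Y, 0 ≤ a → 0 ≤ b → 0 ≤ a * b)
    (hfalgY : ∀ a b z : Y, a ⊓ b = 0 → 0 ≤ z → (z * a) ⊓ b = 0 ∧ (a * z) ⊓ b = 0)
    (harchY : ∀ a b : Y, 0 ≤ a → 0 ≤ b → (∀ k : ℕ, k • a ≤ b) → a = 0)
    (hucY : UniformlyComplete Y)
    (X : Set Y) (hX : IsSublatticeAlgebraSet X) :
    let Xbar : Set Y := ⋂₀ {Z : Set Y | IsSublatticeSet Z ∧ X ⊆ Z ∧ UCSet Z}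
    IsSublatticeAlgebraSet Xbar ∧
    ∀ (A : Type v) [Lattice A] [NonUnitalRing A] [Module ℝ A],
      ∀ [CovariantClass A A (· + ·) (· ≤ ·)] [IsScalarTower ℝ A A] [SMulCommClass ℝ A A],
      (∀ (c : ℝ) (a : A), 0 ≤ c → 0 ≤ a → 0 ≤ c • a) →
      (∀ a b : A, 0 ≤ a → 0 ≤ b → 0 ≤ a * b) →
      (∀ a b z : A, a ⊓ b = 0 → 0 ≤ z → (z * a) ⊓ b = 0 ∧ (a * z) ⊓ b = 0) →
      (∀ a b : A, 0 ≤ a → 0 ≤ b → (∀ k : ℕ, k • a ≤ b) → a = 0) →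
      UniformlyComplete A →
      ∀ T : Y → A, IsLatAlgHomOn X T →
        (∃ Tbar : Y → A, IsLatAlgHomOn Xbar Tbar ∧ ∀ a ∈ X, Tbar a = T a) ∧
        (∀ T₁ T₂ : Y → A, IsLatAlgHomOn Xbar T₁ → IsLatAlgHomOn Xbar T₂ →
          (∀ a ∈ X, T₁ a = T a) → (∀ a ∈ X, T₂ a = T a) → ∀ a ∈ Xbar, T₁ a = T₂ a) := by
  intro Xbar
  have : IsOrderedAddMonoid Y :=
    { add_le_add_left := fun a b h c => by
        rw [add_comm a, add_comm b]
        exact CovariantClass.elim c h }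
  have := PosSMulMono.of_smul_nonneg fun c hc a ha => hsmulposY c a hc ha
  have hXbar : IsSublatticeAlgebraSet Xbar := by
    obtain ⟨G, hGalg, -, -, hGX⟩ := exists_graph_extension hmulposY harchY hucY hmulposY harchY
      hucY hX (T := id) ⟨by simp, by simp, by simp, by simp⟩
    refine ⟨isSublatticeSet_uniformHull X, ?_⟩
    rw [show Xbar = Prod.fst '' G from hGX.symm]
    rintro _ ⟨p, hp, rfl⟩ _ ⟨q, hq, rfl⟩
    exact ⟨p * q, hGalg.2 p hp q hq, rfl⟩
  refine ⟨hXbar, ?_⟩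
  intro A _ _ _ _ _ _ hsmulposA hmulposA _ harchA hucA T hT
  have : IsOrderedAddMonoid A :=
    { add_le_add_left := fun a b h c => by
        rw [add_comm a, add_comm b]
        exact CovariantClass.elim c h }
  have := PosSMulMono.of_smul_nonneg fun c hc a ha => hsmulposA c a hc ha
  refine ⟨?_, fun T₁ T₂ h₁ h₂ e₁ e₂ => h₁.eq_on_uniformHull harchY hucY harchA h₂
    fun a ha => (e₁ a ha).trans (e₂ a ha).symm⟩
  obtain ⟨G, hGalg, hG, hGT, hGX⟩ := exists_graph_extension hmulposY harchY hucY hmulposA harchA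
    hucA hX hT
  have hex : ∀ y : Y, ∃ a : A, y ∈ Xbar → (y, a) ∈ G := fun y => by
    by_cases hy : y ∈ Xbar
    · obtain ⟨⟨_, a⟩, hp, rfl⟩ : y ∈ Prod.fst '' G := hGX ▸ hy
      exact ⟨a, fun _ => hp⟩
    · exact ⟨0, fun h => absurd h hy⟩
  choose S hS using hex
  refine ⟨S, ⟨fun a ha b hb => ?_, fun c a ha => ?_, fun a ha b hb => ?_, fun a ha b hb => ?_⟩,
    fun a ha => hG.eq_of_mem (hS a (subset_uniformHull X ha)) (hGT a ha)⟩
  · exact hG.eq_of_mem (hS _ (hXbar.1.add_mem ha hb)) (hGalg.1.add_mem (hS a ha) (hS b hb))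
  · exact hG.eq_of_mem (hS _ (hXbar.1.smul_mem c ha)) (hGalg.1.smul_mem c (hS a ha))
  · exact hG.eq_of_mem (hS _ (hXbar.1.sup_mem ha hb)) (hGalg.1.sup_mem (hS a ha) (hS b hb))
  · exact hG.eq_of_mem (hS _ (hXbar.2 a ha b hb)) (hGalg.2 _ (hS a ha) _ (hS b hb))
end

section
/- For every n ∈ ℕ, every uniformly complete Archimedean f-algebra A with multiplicative identity 1_A, and every a₁, …, aₙ ∈ A, there exists a unique lattice-algebra homomorphism Ψ : PG_n → A with Ψ(𝟙) = 1_A and Ψ(πᵢ) = aᵢ for i = 1, …, n. (Equivalently: PG_n, together with the map i ↦ πᵢ, is the free uniformly complete f-algebra with identity over {1, …, n}.) -/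
open scoped BigOperators

/-- An Archimedean `f`-algebra with a multiplicative identity. -/
class IsArchFAlgebra (A : Type*) [Lattice A] [Ring A] [Module ℝ A] : Prop extends
    IsOrderedAddMonoid A, IsOrderedModule ℝ A, PosMulMono A, MulPosMono A,
    IsScalarTower ℝ A A, SMulCommClass ℝ A A where
  mul_inf_eq_zero : ∀ a b z : A, a ⊓ b = 0 → 0 ≤ z → (z * a) ⊓ b = 0 ∧ (a * z) ⊓ b = 0
  eq_zero_of_nsmul_le : ∀ a b : A, 0 ≤ a → 0 ≤ b → (∀ k : ℕ, k • a ≤ b) → a = 0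

namespace IsArchFAlgebra

section Ring

variable {A : Type*} [Lattice A] [Ring A] [Module ℝ A] [IsArchFAlgebra A]

lemma mul_eq_zero_of_inf_eq_zero {p q : A} (h : p ⊓ q = 0) : p * q = 0 := by
  have hp : 0 ≤ p := h ▸ inf_le_left
  have hq : 0 ≤ q := h ▸ inf_le_right
  have h1 : q ⊓ (p * q) = 0 := by
    rw [inf_comm]
    exact (mul_inf_eq_zero p q q h hq).2
  simpa using (mul_inf_eq_zero q (p * q) p h1 hp).1

lemma mul_mul_eq_zero_of_inf_eq_zero {p q u : A} (h : p ⊓ q = 0) (hu : 0 ≤ u) :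
    p * u * q = 0 :=
  mul_eq_zero_of_inf_eq_zero (mul_inf_eq_zero p q u h hu).2

lemma posPart_mul_negPart (x : A) : x⁺ * x⁻ = 0 :=
  mul_eq_zero_of_inf_eq_zero (posPart_inf_negPart_eq_zero x)

lemma negPart_mul_posPart (x : A) : x⁻ * x⁺ = 0 :=
  mul_eq_zero_of_inf_eq_zero (by rw [inf_comm]; exact posPart_inf_negPart_eq_zero x)

lemma posPart_mul_self (x : A) : x⁺ * x = x⁺ * x⁺ := by
  have h := mul_sub x⁺ x⁺ x⁻
  rwa [posPart_sub_negPart, posPart_mul_negPart, sub_zero] at h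

lemma mul_self_nonneg' (x : A) : 0 ≤ x * x := by
  have h : x * x = x⁺ * x⁺ + x⁻ * x⁻ := by
    conv_lhs => rw [← posPart_sub_negPart x]
    rw [sub_mul, mul_sub, mul_sub, posPart_mul_negPart, negPart_mul_posPart]
    abel
  rw [h]
  exact add_nonneg (mul_nonneg (posPart_nonneg x) (posPart_nonneg x))
    (mul_nonneg (negPart_nonneg x) (negPart_nonneg x))

lemma one_nonneg : (0 : A) ≤ 1 := by
  simpa using mul_self_nonneg' (1 : A)

lemma mul_le_abs_mul_abs (x y : A) : x * y ≤ |x| * |y| := by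
  have h1 : 0 ≤ (|x| - x) * (|y| + y) :=
    mul_nonneg (sub_nonneg.2 (le_abs_self x)) (neg_le_iff_add_nonneg.1 (neg_le_abs y) |>.trans_eq
      (by abel))
  have h2 : 0 ≤ (|x| + x) * (|y| - y) :=
    mul_nonneg (neg_le_iff_add_nonneg.1 (neg_le_abs x) |>.trans_eq (by abel))
      (sub_nonneg.2 (le_abs_self y))
  have h3 : (|x| - x) * (|y| + y) + (|x| + x) * (|y| - y) = (2 : ℝ) • (|x| * |y| - x * y) := by
    rw [two_smul]
    noncomm_ring
  have h4 : 0 ≤ (2 : ℝ) • (|x| * |y| - x * y) := h3 ▸ add_nonneg h1 h2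
  exact sub_nonneg.1 (le_of_smul_le_smul_left (by simpa using h4) (two_pos (α := ℝ)))

lemma abs_mul_le (x y : A) : |x * y| ≤ |x| * |y| := by
  refine abs_le'.2 ⟨mul_le_abs_mul_abs x y, ?_⟩
  simpa using mul_le_abs_mul_abs (-x) y

lemma posPart_mul_eq_zero {w h : A} (hh : 0 ≤ h) (hw : w * h ≤ 0) : w⁺ * h = 0 := by
  have h1 : w⁻ ⊓ (w⁺ * h) = 0 := by
    rw [inf_comm]
    exact (mul_inf_eq_zero _ _ h (posPart_inf_negPart_eq_zero w) hh).2
  have h2 := (mul_inf_eq_zero _ _ h h1 hh).2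
  have h3 : w⁺ * h ≤ w⁻ * h := by
    rw [← sub_nonpos, ← sub_mul, posPart_sub_negPart]
    exact hw
  rwa [inf_eq_right.2 h3] at h2

lemma eq_zero_of_mul_self_eq_zero {m : A} (hm : 0 ≤ m) (h : m * m = 0) : m = 0 := by
  refine eq_zero_of_nsmul_le m 1 hm one_nonneg fun k => ?_
  rw [← sub_nonpos, ← posPart_eq_zero]
  set x := k • m - 1 with hx
  have hkm : 0 ≤ k • m := nsmul_nonneg hm k
  have h1 : x⁺ ≤ k • m := sup_le (sub_le_self _ one_nonneg) hkm
  have h2 : x⁺ * (k • m) - x⁺ = x⁺ * x⁺ := by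
    rw [← posPart_mul_self, hx, mul_sub, mul_one]
  have h3 : x⁺ ≤ x⁺ * (k • m) :=
    sub_nonneg.1 (h2 ▸ mul_nonneg (posPart_nonneg x) (posPart_nonneg x))
  have h4 : x⁺ * (k • m) ≤ (k • m) * (k • m) := mul_le_mul_of_nonneg_right h1 hkm
  have h5 : (k • m) * (k • m) = 0 := by
    rw [smul_mul_smul_comm, h, smul_zero]
  exact le_antisymm (h3.trans (h4.trans_eq h5)) (posPart_nonneg x)

lemma inf_eq_zero_of_mul_eq_zero {p q : A} (hp : 0 ≤ p) (hq : 0 ≤ q) (h : p * q = 0) :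
    p ⊓ q = 0 := by
  have h0 : 0 ≤ p ⊓ q := le_inf hp hq
  refine eq_zero_of_mul_self_eq_zero h0 (le_antisymm ?_ (mul_nonneg h0 h0))
  rw [← h]
  exact mul_le_mul inf_le_left inf_le_right h0 hp

lemma nonpos_of_forall_le_smul {x v : A} (hv : 0 ≤ v) (h : ∀ ε : ℝ, 0 < ε → x ≤ ε • v) :
    x ≤ 0 := by
  rw [← posPart_eq_zero]
  refine eq_zero_of_nsmul_le _ v (posPart_nonneg x) hv fun k => ?_
  have hk : (0 : ℝ) < k + 1 := by positivity
  have h1 : x⁺ ≤ ((k : ℝ) + 1)⁻¹ • v :=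
    sup_le (h _ (by positivity)) (smul_nonneg (by positivity) hv)
  have h2 : ((k : ℝ) + 1) • x⁺ ≤ v := by
    simpa [smul_smul, hk.ne'] using smul_le_smul_of_nonneg_left h1 hk.le
  refine le_trans ?_ h2
  rw [← Nat.cast_smul_eq_nsmul ℝ]
  exact smul_le_smul_of_nonneg_right (by linarith) (posPart_nonneg x)

lemma smul_one_nonneg {c : ℝ} (hc : 0 ≤ c) : (0 : A) ≤ c • (1 : A) :=
  smul_nonneg hc one_nonneg

/-- In a lattice-ordered real vector space, the supremum dominates the average. -/
lemma half_smul_add_le_sup (x y : A) : (2⁻¹ : ℝ) • (x + y) ≤ x ⊔ y := by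
  have h : x + y ≤ (2 : ℝ) • (x ⊔ y) := by
    rw [two_smul]
    exact add_le_add le_sup_left le_sup_right
  simpa [smul_smul] using smul_le_smul_of_nonneg_left h (by norm_num : (0 : ℝ) ≤ 2⁻¹)

/-- In a lattice-ordered real vector space, the infimum is dominated by the average. -/
lemma inf_le_half_smul_add (x y : A) : x ⊓ y ≤ (2⁻¹ : ℝ) • (x + y) := by
  have h : (2 : ℝ) • (x ⊓ y) ≤ x + y := by
    rw [two_smul]
    exact add_le_add inf_le_left inf_le_right
  simpa [smul_smul] using smul_le_smul_of_nonneg_left h (by norm_num : (0 : ℝ) ≤ 2⁻¹)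

/-- Every `k > 0` lies in the complement `G` of a prime ideal of the underlying lattice which
contains `0`, and `G` may be taken to contain everything dominating a positive multiple
of `k`. -/
lemma exists_prime_filter {k : A} (hk : 0 ≤ k) (hk0 : k ≠ 0) :
    ∃ G : Set A, (∀ x y, x ≤ y → x ∈ G → y ∈ G) ∧ (∀ x ∈ G, ∀ y ∈ G, x ⊓ y ∈ G) ∧
      (∀ x y, x ⊔ y ∈ G → x ∈ G ∨ y ∈ G) ∧ (∀ x ≤ 0, x ∉ G) ∧
      ∀ (x : A) (c : ℝ), 0 < c → c • k ≤ x → x ∈ G := by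
  let _ : DistribLattice A := AddCommGroup.toDistribLattice A
  have hF : Order.IsPFilter {x : A | ∃ c : ℝ, 0 < c ∧ c • k ≤ x} := by
    refine Order.IsPFilter.of_def ⟨k, 1, one_pos, by simp⟩ ?_ ?_
    · rintro x ⟨c, hc, hx⟩ y ⟨d, hd, hy⟩
      refine ⟨x ⊓ y, ⟨min c d, lt_min hc hd, le_inf ?_ ?_⟩, inf_le_left, inf_le_right⟩
      · exact (smul_le_smul_of_nonneg_right (min_le_left c d) hk).trans hx
      · exact (smul_le_smul_of_nonneg_right (min_le_right c d) hk).trans hy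
    · rintro x y hxy ⟨c, hc, hx⟩
      exact ⟨c, hc, hx.trans hxy⟩
  have hdisj : Disjoint (hF.toPFilter : Set A) (Order.Ideal.principal (0 : A) : Set A) := by
    rw [Set.disjoint_left]
    rintro x ⟨c, hc, hx⟩ hx0
    have h1 : c • k ≤ c • (0 : A) := by
      rw [smul_zero]
      exact hx.trans hx0
    exact hk0 (le_antisymm (le_of_smul_le_smul_left h1 hc) hk)
  obtain ⟨J, hJ, hIJ, hFJ⟩ := DistribLattice.prime_ideal_of_disjoint_filter_ideal hdisj
  refine ⟨(J : Set A)ᶜ, fun x y hxy hx hy => hx (J.lower hxy hy), fun x hx y hy hxy =>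
    (hJ.mem_or_mem hxy).elim hx hy, fun x y hxy => ?_, fun x hx hxJ => hxJ (hIJ hx),
    fun x c hc hx => Set.disjoint_left.1 hFJ ⟨c, hc, hx⟩⟩
  by_contra! h
  exact hxy (J.sup_mem (not_not.1 h.1) (not_not.1 h.2))

variable {ι : Type*}

/-- `h` is positive and supported where each `a i` is within `δ` of the scalar `l i`. -/
def Near (a : ι → A) (l : ι → ℝ) (δ : ℝ) (h : A) : Prop :=
  0 ≤ h ∧ ∀ i, h ≤ (δ • 1 - |a i - l i • 1|)⁺

lemma Near.mono {a : ι → A} {l : ι → ℝ} {δ δ' : ℝ} {h : A} (hn : Near a l δ h) (hδ : δ ≤ δ') :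
    Near a l δ' h :=
  ⟨hn.1, fun i => (hn.2 i).trans
    (posPart_mono (sub_le_sub_right (smul_le_smul_of_nonneg_right hδ one_nonneg) _))⟩

lemma exists_scalar_of_prime {G : Set A} (hup : ∀ x y, x ≤ y → x ∈ G → y ∈ G)
    (hinf : ∀ x ∈ G, ∀ y ∈ G, x ⊓ y ∈ G) (hprime : ∀ x y, x ⊔ y ∈ G → x ∈ G ∨ y ∈ G)
    (hnonpos : ∀ x ≤ 0, x ∉ G) (hone : ∀ c : ℝ, 0 < c → c • (1 : A) ∈ G)
    {x : A} {R : ℝ} (h1 : x + R • 1 ∈ G) (h2 : R • 1 - x ∈ G) :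
    ∃ l : ℝ, ∀ δ : ℝ, 0 < δ → δ • 1 - |x - l • 1| ∈ G := by
  set T : Set ℝ := {t | x - t • 1 ∈ G} with hT
  have hne : (-R) ∈ T := by
    simpa [hT] using h1
  have hbdd : BddAbove T := by
    refine ⟨R, fun t ht => ?_⟩
    by_contra! hRt
    refine hnonpos _ ?_ (hinf _ ht _ h2)
    refine (inf_le_half_smul_add _ _).trans ?_
    have h3 : (2⁻¹ : ℝ) • ((x - t • (1 : A)) + (R • 1 - x)) = -((2⁻¹ * (t - R)) • (1 : A)) := by
      module
    rw [h3]
    exact neg_nonpos.2 (smul_one_nonneg (by linarith))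
  refine ⟨sSup T, fun δ hδ => ?_⟩
  obtain ⟨t, ht, hlt⟩ := exists_lt_of_lt_csSup ⟨_, hne⟩ (sub_lt_self (sSup T) hδ)
  have hlow : x - (sSup T - δ) • 1 ∈ G :=
    hup _ _ (sub_le_sub_left (smul_le_smul_of_nonneg_right hlt.le one_nonneg) _) ht
  have hhigh : (sSup T + δ) • 1 - x ∈ G := by
    have hnot : x - (sSup T + δ / 2) • 1 ∉ G := fun hmem => by
      have := le_csSup hbdd (show sSup T + δ / 2 ∈ T from hmem)
      linarith
    refine (hprime _ _ (hup _ _ (half_smul_add_le_sup _ _) ?_)).resolve_left hnot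
    have h3 : (2⁻¹ : ℝ) • ((x - (sSup T + δ / 2) • (1 : A)) + ((sSup T + δ) • 1 - x)) =
        (δ / 4) • 1 := by
      module
    rw [h3]
    exact hone _ (by positivity)
  refine hup _ _ ?_ (hinf _ hlow _ hhigh)
  rw [le_sub_comm]
  refine abs_le'.2 ⟨?_, ?_⟩
  · rw [le_sub_comm]
    refine inf_le_right.trans_eq ?_
    module
  · rw [le_sub_comm]
    refine inf_le_left.trans_eq ?_
    module

lemma eq_zero_of_forall_near [Finite ι] (a : ι → A) {y : A} (hy : 0 ≤ y)
    (h : ∀ l : ι → ℝ, ∃ δ : ℝ, 0 < δ ∧ ∀ h, Near a l δ h → y ⊓ h = 0) : y = 0 := by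
  classical
  cases nonempty_fintype ι
  by_contra hy0
  set s : A := ∑ i, |a i| with hs
  have hs0 : 0 ≤ s := Finset.sum_nonneg fun i _ => abs_nonneg _
  have hle : ∀ i, |a i| ≤ s := fun i =>
    Finset.single_le_sum (f := fun i => |a i|) (fun i _ => abs_nonneg _) (Finset.mem_univ i)
  obtain ⟨n, hn⟩ : ∃ n : ℕ, y ⊓ ((n : ℝ) • 1 - s)⁺ ≠ 0 := by
    by_contra! hall
    refine hy0 (eq_zero_of_nsmul_le y (y * s) hy (mul_nonneg hy hs0) fun n => ?_)
    have h1 := mul_eq_zero_of_inf_eq_zero (hall n)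
    have h2 : y * ((n : ℝ) • 1 - s) ≤ 0 := by
      rw [← h1]
      exact mul_le_mul_of_nonneg_left (le_posPart _) hy
    rw [mul_sub, mul_smul_comm, mul_one, Nat.cast_smul_eq_nsmul, sub_nonpos] at h2
    exact h2
  set R : ℝ := n + 1 with hR
  have hRpos : 0 < R := by positivity
  set k : A := y ⊓ ((n : ℝ) • 1 - s)⁺ with hk
  have hk0 : 0 ≤ k := le_inf hy (posPart_nonneg _)
  obtain ⟨G, hup, hinf, hprime, hnonpos, hG⟩ := exists_prime_filter hk0 hn
  have hkG : ∀ x, k ≤ x → x ∈ G := fun x hx => hG x 1 one_pos (by simpa using hx)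
  have hpos : ∀ x, x⁺ ∈ G → x ∈ G := fun x hx =>
    (hprime x 0 hx).resolve_right (hnonpos 0 le_rfl)
  have hnR : (n : ℝ) • (1 : A) ≤ R • 1 :=
    smul_le_smul_of_nonneg_right (by linarith) one_nonneg
  have hone : ∀ c : ℝ, 0 < c → c • (1 : A) ∈ G := fun c hc => by
    refine hG _ (c / R) (by positivity) ?_
    have h1 : k ≤ R • 1 := inf_le_right.trans
      (sup_le ((sub_le_self _ hs0).trans hnR) (smul_one_nonneg hRpos.le))
    refine (smul_le_smul_of_nonneg_left h1 (by positivity : 0 ≤ c / R)).trans_eq ?_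
    rw [smul_smul, div_mul_cancel₀ _ hRpos.ne']
  have hsG : (n : ℝ) • 1 - s ∈ G := hpos _ (hkG _ inf_le_right)
  have hscal : ∀ i, ∃ l : ℝ, ∀ δ : ℝ, 0 < δ → δ • 1 - |a i - l • 1| ∈ G := fun i => by
    refine exists_scalar_of_prime (R := n) hup hinf hprime hnonpos hone
      (hup _ _ ?_ hsG) (hup _ _ ?_ hsG)
    · rw [sub_eq_neg_add]
      exact add_le_add_left (neg_le.1 ((neg_le_abs _).trans (hle i))) _
    · exact sub_le_sub_left ((le_abs_self _).trans (hle i)) _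
  choose l hl using hscal
  obtain ⟨δ, hδ, hnear⟩ := h l
  have hfin : ∀ S : Finset ι, ∃ g ∈ G, 0 ≤ g ∧ ∀ i ∈ S, g ≤ (δ • 1 - |a i - l i • 1|)⁺ := by
    intro S
    induction S using Finset.induction_on with
    | empty => exact ⟨1, by simpa using hone 1 one_pos, one_nonneg, by simp⟩
    | insert j S _ ih =>
      obtain ⟨g, hgG, hg0, hg⟩ := ih
      refine ⟨g ⊓ (δ • 1 - |a j - l j • 1|)⁺,
        hinf _ hgG _ (hup _ _ (le_posPart _) (hl j δ hδ)), le_inf hg0 (posPart_nonneg _), ?_⟩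
      intro i hi
      rcases Finset.mem_insert.1 hi with rfl | hi
      · exact inf_le_right
      · exact inf_le_left.trans (hg i hi)
  obtain ⟨g, hgG, hg0, hg⟩ := hfin Finset.univ
  exact hnonpos _ (hnear g ⟨hg0, fun i => hg i (Finset.mem_univ i)⟩).le
    (hinf _ (hkG _ inf_le_left) _ hgG)

/-- Positivity is a local property over the joint spectrum of a finite family. -/
lemma nonpos_of_forall_near [Finite ι] (a : ι → A) {w : A}
    (h : ∀ l : ι → ℝ, ∃ δ : ℝ, 0 < δ ∧ ∀ h, Near a l δ h → w * h ≤ 0) : w ≤ 0 := by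
  rw [← posPart_eq_zero]
  refine eq_zero_of_forall_near a (posPart_nonneg w) fun l => ?_
  obtain ⟨δ, hδ, hw⟩ := h l
  exact ⟨δ, hδ, fun h hn => inf_eq_zero_of_mul_eq_zero (posPart_nonneg w) hn.1
    (posPart_mul_eq_zero hn.1 (hw h hn))⟩

lemma abs_sub_mul_mul_le {a : ι → A} {l : ι → ℝ} {δ : ℝ} {h u : A} (hn : Near a l δ h)
    (hu : 0 ≤ u) (i : ι) : |a i - l i • 1| * u * h ≤ δ • (u * h) := by
  set x := |a i - l i • 1| - δ • (1 : A) with hx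
  have h1 : x⁺ ⊓ h = 0 := by
    refine le_antisymm ?_ (le_inf (posPart_nonneg x) hn.1)
    rw [← posPart_inf_negPart_eq_zero x]
    refine inf_le_inf_left _ ((hn.2 i).trans_eq ?_)
    rw [← posPart_neg, hx, neg_sub]
  have h2 : x * u * h ≤ 0 := by
    rw [← mul_mul_eq_zero_of_inf_eq_zero h1 hu]
    exact mul_le_mul_of_nonneg_right (mul_le_mul_of_nonneg_right (le_posPart x) hu) hn.1
  rw [hx, sub_mul, sub_mul, sub_nonpos, smul_mul_assoc, smul_mul_assoc, one_mul] at h2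
  exact h2

lemma abs_sub_mul_le {a : ι → A} {l : ι → ℝ} {δ : ℝ} {h : A} (hn : Near a l δ h) (i : ι) :
    |a i - l i • 1| * h ≤ δ • h := by
  simpa using abs_sub_mul_mul_le hn one_nonneg i

lemma commutator_le {u : A} (hu : 0 ≤ u) (x : A) : u * x - x * u ≤ 0 := by
  refine nonpos_of_forall_le_smul hu fun ε hε => sub_nonpos.1 ?_
  refine nonpos_of_forall_near (fun _ : Unit => x) fun l => ⟨ε / 2, by positivity, fun h hn => ?_⟩
  set y := x - l () • (1 : A) with hy
  have h1 : |y| * u * h ≤ (ε / 2) • (u * h) := abs_sub_mul_mul_le hn hu ()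
  have h2 : u * (|y| * h) ≤ u * ((ε / 2) • h) :=
    mul_le_mul_of_nonneg_left (abs_sub_mul_le hn ()) hu
  have h3 : u * x - x * u = u * y - y * u := by
    rw [hy, mul_sub, sub_mul, mul_smul_comm, smul_mul_assoc, mul_one, one_mul]
    abel
  have h4 : u * x - x * u ≤ u * |y| + |y| * u := by
    rw [h3, sub_eq_add_neg, ← neg_mul]
    exact add_le_add (mul_le_mul_of_nonneg_left (le_abs_self y) hu)
      (mul_le_mul_of_nonneg_right (neg_le_abs y) hu)
  rw [sub_mul, sub_nonpos]
  refine (mul_le_mul_of_nonneg_right h4 hn.1).trans ?_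
  rw [add_mul, mul_assoc u]
  refine (add_le_add h2 h1).trans_eq ?_
  rw [mul_smul_comm, ← add_smul, add_halves, smul_mul_assoc]

/-- Archimedean `f`-algebras with identity are commutative. -/
theorem mul_comm' (x y : A) : x * y = y * x := by
  have key : ∀ u : A, 0 ≤ u → ∀ v : A, u * v = v * u := fun u hu v => by
    refine le_antisymm (sub_nonpos.1 (commutator_le hu v)) ?_
    have h := commutator_le hu (-v)
    rwa [mul_neg, neg_mul, sub_neg_eq_add, neg_add_eq_sub, sub_nonpos] at h
  rw [← posPart_sub_negPart x, sub_mul, mul_sub, key _ (posPart_nonneg x),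
    key _ (negPart_nonneg x)]

end Ring

section CommRing

variable {A : Type*} [Lattice A] [CommRing A] [Module ℝ A] [IsArchFAlgebra A] {ι : Type*}

/-- `z` is the value at `a` of the function `f`: locally near every point `l` of the joint
spectrum, `z` is close to the scalar `f l`. -/
def IsValue (a : ι → A) (f : (ι → ℝ) → ℝ) (z : A) : Prop :=
  ∀ (l : ι → ℝ) (ε : ℝ), 0 < ε →
    ∃ δ : ℝ, 0 < δ ∧ ∀ h, Near a l δ h → |z - f l • 1| * h ≤ ε • h

namespace IsValue

variable {a : ι → A} {f g : (ι → ℝ) → ℝ} {z w : A}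

lemma both (hf : IsValue a f z) (hg : IsValue a g w) (l : ι → ℝ) {ε η : ℝ} (hε : 0 < ε)
    (hη : 0 < η) : ∃ δ : ℝ, 0 < δ ∧ ∀ h, Near a l δ h →
      |z - f l • 1| * h ≤ ε • h ∧ |w - g l • 1| * h ≤ η • h := by
  obtain ⟨δ₁, hδ₁, h₁⟩ := hf l ε hε
  obtain ⟨δ₂, hδ₂, h₂⟩ := hg l η hη
  exact ⟨min δ₁ δ₂, lt_min hδ₁ hδ₂, fun h hn =>
    ⟨h₁ h (hn.mono (min_le_left _ _)), h₂ h (hn.mono (min_le_right _ _))⟩⟩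

lemma coord (a : ι → A) (i : ι) : IsValue a (fun t => t i) (a i) := fun _ ε hε =>
  ⟨ε, hε, fun _ hn => abs_sub_mul_le hn i⟩

lemma const (a : ι → A) (c : ℝ) : IsValue a (fun _ => c) (c • (1 : A)) := fun _ ε hε =>
  ⟨1, one_pos, fun h hn => by simpa using smul_nonneg hε.le hn.1⟩

lemma of_abs_le_add {f' : (ι → ℝ) → ℝ} {z' : A} (hf : IsValue a f z) (hg : IsValue a g w)
    (h : ∀ l, |z' - f' l • 1| ≤ |z - f l • 1| + |w - g l • 1|) : IsValue a f' z' := by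
  intro l ε hε
  obtain ⟨δ, hδ, hn⟩ := hf.both hg l (half_pos hε) (half_pos hε)
  refine ⟨δ, hδ, fun x hx => ?_⟩
  refine (mul_le_mul_of_nonneg_right (h l) hx.1).trans ?_
  rw [add_mul]
  refine (add_le_add (hn x hx).1 (hn x hx).2).trans_eq ?_
  rw [← add_smul, add_halves]

lemma add (hf : IsValue a f z) (hg : IsValue a g w) : IsValue a (f + g) (z + w) := by
  refine hf.of_abs_le_add hg fun l => ?_
  have h : z + w - (f + g) l • (1 : A) = (z - f l • 1) + (w - g l • 1) := by
    rw [Pi.add_apply]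
    module
  rw [h]
  exact abs_add_le _ _

lemma smul_one_sup (r s : ℝ) : (r ⊔ s) • (1 : A) = r • 1 ⊔ s • 1 := by
  rcases le_total r s with h | h
  · rw [sup_eq_right.2 h, sup_eq_right.2 (smul_le_smul_of_nonneg_right h one_nonneg)]
  · rw [sup_eq_left.2 h, sup_eq_left.2 (smul_le_smul_of_nonneg_right h one_nonneg)]

lemma sup (hf : IsValue a f z) (hg : IsValue a g w) : IsValue a (f ⊔ g) (z ⊔ w) := by
  refine hf.of_abs_le_add hg fun l => ?_
  rw [Pi.sup_apply, smul_one_sup]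
  rw [← sub_add_sub_cancel _ (f l • 1 ⊔ w)]
  refine (abs_add_le _ _).trans (add_le_add ?_ ?_)
  · exact abs_sup_sub_sup_le_abs _ _ _
  · rw [sup_comm _ w, sup_comm _ (g l • (1 : A))]
    exact abs_sup_sub_sup_le_abs _ _ _

lemma abs_smul_le (c : ℝ) (x : A) : |c • x| ≤ |c| • |x| := by
  have key : ∀ y : A, c • y ≤ |c| • |y| := fun y => by
    rcases le_total 0 c with hc | hc
    · rw [abs_of_nonneg hc]
      exact smul_le_smul_of_nonneg_left (le_abs_self y) hc
    · rw [abs_of_nonpos hc, ← neg_smul_neg]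
      exact smul_le_smul_of_nonneg_left (neg_le_abs y) (neg_nonneg.2 hc)
  refine abs_le'.2 ⟨key x, ?_⟩
  rw [← smul_neg]
  exact (key (-x)).trans_eq (by rw [abs_neg])

lemma mul (hf : IsValue a f z) (hg : IsValue a g w) : IsValue a (f * g) (z * w) := by
  intro l ε hε
  set η : ℝ := min 1 (ε / (1 + |f l| + |g l|)) with hη
  have hη0 : 0 < η := lt_min one_pos (by positivity)
  have hη1 : η * (1 + |f l| + |g l|) ≤ ε :=
    (le_div_iff₀ (by positivity)).1 (min_le_right _ _)
  obtain ⟨δ, hδ, hn⟩ := hf.both hg l hη0 hη0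
  refine ⟨δ, hδ, fun x hx => ?_⟩
  obtain ⟨h1, h2⟩ := hn x hx
  set u := z - f l • (1 : A) with hu
  set v := w - g l • (1 : A) with hv
  have h3 : z * w - (f * g) l • (1 : A) = u * v + g l • u + f l • v := by
    have hz : z = u + f l • 1 := by rw [hu]; abel
    have hw : w = v + g l • 1 := by rw [hv]; abel
    rw [hz, hw, Pi.mul_apply, add_mul, mul_add, mul_add, smul_mul_smul_comm, mul_smul_comm,
      smul_mul_assoc, mul_one, one_mul, mul_one]
    abel
  have h4 : |z * w - (f * g) l • (1 : A)| ≤ |u| * |v| + |g l| • |u| + |f l| • |v| := by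
    rw [h3]
    exact (abs_add_le _ _).trans (add_le_add ((abs_add_le _ _).trans
      (add_le_add (abs_mul_le _ _) (abs_smul_le _ _))) (abs_smul_le _ _))
  have h5 : |u| * (|v| * x) ≤ η • x := by
    have h6 : |v| * x ≤ x := h2.trans
      ((smul_le_smul_of_nonneg_right (min_le_left _ _) hx.1).trans_eq (one_smul ℝ x))
    exact (mul_le_mul_of_nonneg_left h6 (abs_nonneg u)).trans h1
  refine (mul_le_mul_of_nonneg_right h4 hx.1).trans ?_
  rw [add_mul, add_mul, mul_assoc, smul_mul_assoc, smul_mul_assoc]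
  refine (add_le_add (add_le_add h5 (smul_le_smul_of_nonneg_left h1 (abs_nonneg _)))
    (smul_le_smul_of_nonneg_left h2 (abs_nonneg _))).trans ?_
  have h7 : η • x + |g l| • η • x + |f l| • η • x = (η * (1 + |f l| + |g l|)) • x := by
    module
  rw [h7]
  exact smul_le_smul_of_nonneg_right hη1 hx.1

lemma smul (c : ℝ) (hf : IsValue a f z) : IsValue a (c • f) (c • z) := by
  have h := (const a c).mul hf
  rw [smul_mul_assoc, one_mul] at h
  exact h

lemma sub (hf : IsValue a f z) (hg : IsValue a g w) : IsValue a (f - g) (z - w) := by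
  have h := hf.add (hg.smul (-1))
  rwa [neg_one_smul, neg_one_smul, ← sub_eq_add_neg, ← sub_eq_add_neg] at h

lemma nonneg [Finite ι] (hf : IsValue a f z) (h0 : 0 ≤ f) : 0 ≤ z := by
  rw [← neg_nonpos]
  refine nonpos_of_forall_le_smul one_nonneg fun ε hε => sub_nonpos.1 ?_
  refine nonpos_of_forall_near a fun l => ?_
  obtain ⟨δ, hδ, hn⟩ := hf l ε hε
  refine ⟨δ, hδ, fun x hx => ?_⟩
  rw [sub_mul, smul_mul_assoc, one_mul, sub_nonpos]
  refine le_trans (mul_le_mul_of_nonneg_right ?_ hx.1) (hn x hx)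
  refine le_trans ?_ (neg_le_abs _)
  rw [neg_sub, le_sub_iff_add_le, neg_add_cancel]
  exact smul_one_nonneg (h0 l)

lemma mono [Finite ι] (hf : IsValue a f z) (hg : IsValue a g w) (h : f ≤ g) : z ≤ w :=
  sub_nonneg.1 ((hg.sub hf).nonneg (sub_nonneg.2 h))

lemma unique [Finite ι] (hf : IsValue a f z) (hf' : IsValue a f w) : z = w :=
  le_antisymm (hf.mono hf' le_rfl) (hf'.mono hf le_rfl)

lemma abs_le [Finite ι] (hf : IsValue a f z) (hg : IsValue a g w) (h : ∀ t, |f t| ≤ g t) :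
    |z| ≤ w := by
  refine abs_le'.2 ⟨hf.mono hg fun t => (le_abs_self _).trans (h t), ?_⟩
  have h1 := hf.smul (-1)
  rw [neg_one_smul ℝ z] at h1
  refine h1.mono hg fun t => ?_
  simpa using (neg_le_abs (f t)).trans (h t)

/-- Values are stable under relatively uniform limits. -/
lemma of_approx {p : (ι → ℝ) → ℝ} {v : A} (hp : IsValue a p v)
    (h : ∀ ε : ℝ, 0 < ε → ∃ q y, IsValue a q y ∧ (∀ t, |f t - q t| ≤ ε * p t) ∧
      |y - z| ≤ ε • v) : IsValue a f z := by
  intro l ε hε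
  set c : ℝ := 2 * |p l| + 2 with hc
  have hc0 : 0 < c := by positivity
  obtain ⟨q, y, hq, hfq, hyz⟩ := h (ε / c) (by positivity)
  obtain ⟨δ, hδ, hn⟩ := hq.both hp l (ε := ε / c) (η := 1) (by positivity) one_pos
  refine ⟨δ, hδ, fun x hx => ?_⟩
  obtain ⟨h1, h2⟩ := hn x hx
  have h3 : v * x ≤ (1 + p l) • x := by
    have h4 := (mul_le_mul_of_nonneg_right (le_abs_self (v - p l • 1)) hx.1).trans h2
    rw [sub_mul, smul_mul_assoc, one_mul, sub_le_iff_le_add, ← add_smul] at h4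
    exact h4
  have h5 : |z - f l • (1 : A)| ≤
      (ε / c) • v + |y - q l • 1| + (ε / c * p l) • 1 := by
    have h6 : z - f l • (1 : A) = (z - y) + (y - q l • 1) + (q l - f l) • 1 := by
      module
    rw [h6]
    refine (abs_add_le _ _).trans (add_le_add ((abs_add_le _ _).trans
      (add_le_add_left ?_ _)) ?_)
    · rwa [abs_sub_comm]
    · refine (abs_smul_le _ _).trans ?_
      rw [abs_of_nonneg (one_nonneg (A := A)), abs_sub_comm]
      exact smul_le_smul_of_nonneg_right (hfq l) one_nonneg
  refine (mul_le_mul_of_nonneg_right h5 hx.1).trans ?_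
  rw [add_mul, add_mul, smul_mul_assoc, smul_mul_assoc, one_mul]
  refine (add_le_add_left (add_le_add (smul_le_smul_of_nonneg_left h3 (by positivity)) h1)
    _).trans ?_
  have h7 : (ε / c) • (1 + p l) • x + (ε / c) • x + (ε / c * p l) • x =
      (ε / c * (2 * p l + 2)) • x := by
    module
  rw [h7]
  refine smul_le_smul_of_nonneg_right ?_ hx.1
  rw [div_mul_eq_mul_div, div_le_iff₀ hc0]
  refine mul_le_mul_of_nonneg_left ?_ hε.le
  linarith [le_abs_self (p l)]

end IsValue

end CommRing

end IsArchFAlgebra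

/-- The weight function `1 + ∑ |t i|`. -/
def growthWeight (n : ℕ) (t : Fin n → ℝ) : ℝ := 1 + ∑ i : Fin n, |t i|

lemma one_le_growthWeight {n : ℕ} (t : Fin n → ℝ) : 1 ≤ growthWeight n t :=
  le_add_of_nonneg_right (Finset.sum_nonneg fun _ _ => abs_nonneg _)

lemma continuous_growthWeight (n : ℕ) : Continuous (growthWeight n) := by
  unfold growthWeight
  fun_prop

lemma isCompact_growthWeight_le (n : ℕ) (R : ℝ) :
    IsCompact {t : Fin n → ℝ | growthWeight n t ≤ R} := by
  refine Metric.isCompact_of_isClosed_isBounded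
    (isClosed_le (continuous_growthWeight n) continuous_const) ?_
  refine (Metric.isBounded_closedBall (x := (0 : Fin n → ℝ)) (r := |R|)).subset fun t ht => ?_
  rw [mem_closedBall_zero_iff, pi_norm_le_iff_of_nonneg (abs_nonneg R)]
  intro i
  have h1 : |t i| ≤ ∑ j, |t j| :=
    Finset.single_le_sum (f := fun j => |t j|) (fun _ _ => abs_nonneg _) (Finset.mem_univ i)
  have h2 : 1 + ∑ j, |t j| ≤ R := ht
  rw [Real.norm_eq_abs]
  linarith [le_abs_self R]

/-- A class of functions closed under the lattice-algebra operations and containing the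
constants and the coordinate projections. -/
structure IsFunctionClass {n : ℕ} (C : ((Fin n → ℝ) → ℝ) → Prop) : Prop where
  const : ∀ c : ℝ, C fun _ => c
  coord : ∀ i, C fun t => t i
  add : ∀ f g, C f → C g → C (f + g)
  mul : ∀ f g, C f → C g → C (f * g)
  sup : ∀ f g, C f → C g → C (f ⊔ g)

namespace IsFunctionClass

variable {n : ℕ} {C : ((Fin n → ℝ) → ℝ) → Prop}

lemma smul (hC : IsFunctionClass C) (c : ℝ) {f : (Fin n → ℝ) → ℝ} (hf : C f) : C (c • f) :=
  hC.mul _ _ (hC.const c) hf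

lemma neg (hC : IsFunctionClass C) {f : (Fin n → ℝ) → ℝ} (hf : C f) : C (-f) := by
  simpa using hC.smul (-1) hf

lemma sub (hC : IsFunctionClass C) {f g : (Fin n → ℝ) → ℝ} (hf : C f) (hg : C g) :
    C (f - g) := by
  rw [sub_eq_add_neg]
  exact hC.add _ _ hf (hC.neg hg)

lemma inf (hC : IsFunctionClass C) {f g : (Fin n → ℝ) → ℝ} (hf : C f) (hg : C g) :
    C (f ⊓ g) := by
  have h := hC.neg (hC.sup _ _ (hC.neg hf) (hC.neg hg))
  rwa [neg_sup, neg_neg, neg_neg] at h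

lemma sum (hC : IsFunctionClass C) {ι : Type*} (s : Finset ι) (f : ι → (Fin n → ℝ) → ℝ)
    (hf : ∀ i, C (f i)) : C (∑ i ∈ s, f i) :=
  Finset.sum_induction f C hC.add (hC.const 0) fun i _ => hf i

lemma weight (hC : IsFunctionClass C) : C (growthWeight n) := by
  have h := hC.add _ _ (hC.const 1) (hC.sum Finset.univ (fun i t => |t i|)
    fun i => hC.sup _ _ (hC.coord i) (hC.neg (hC.coord i)))
  convert h using 1
  ext t
  simp [growthWeight]

lemma pow (hC : IsFunctionClass C) {f : (Fin n → ℝ) → ℝ} (hf : C f) (k : ℕ) : C (f ^ k) := by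
  induction k with
  | zero =>
    rw [pow_zero]
    exact hC.const 1
  | succ k ih =>
    rw [pow_succ]
    exact hC.mul _ _ ih hf

lemma exists_near_on_compact (hC : IsFunctionClass C) {K : Set (Fin n → ℝ)} (hK : IsCompact K)
    {f : (Fin n → ℝ) → ℝ} (hf : Continuous f) {ε : ℝ} (hε : 0 < ε) :
    ∃ q, C q ∧ ∀ t ∈ K, |f t - q t| ≤ ε := by
  have : CompactSpace K := isCompact_iff_compactSpace.1 hK
  let S : Subalgebra ℝ C(K, ℝ) :=
    { carrier := {φ | ∃ q, C q ∧ ∀ t : K, φ t = q t}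
      mul_mem' := by
        rintro φ ψ ⟨q, hq, h⟩ ⟨r, hr, h'⟩
        exact ⟨q * r, hC.mul _ _ hq hr, fun t => by simp [h, h']⟩
      add_mem' := by
        rintro φ ψ ⟨q, hq, h⟩ ⟨r, hr, h'⟩
        exact ⟨q + r, hC.add _ _ hq hr, fun t => by simp [h, h']⟩
      algebraMap_mem' := fun c => ⟨fun _ => c, hC.const c, fun t => by simp⟩ }
  have hS : S.SeparatesPoints := by
    intro s t hst
    obtain ⟨i, hi⟩ := Function.ne_iff.1 (Subtype.coe_ne_coe.2 hst)
    exact ⟨_, ⟨⟨fun t : K => t.1 i, (continuous_apply i).comp continuous_subtype_val⟩,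
      ⟨_, hC.coord i, fun _ => rfl⟩, rfl⟩, hi⟩
  obtain ⟨⟨φ, q, hq, hφ⟩, hnear⟩ :=
    ContinuousMap.exists_mem_subalgebra_near_continuous_of_separatesPoints S hS
      (fun t : K => f t) (by fun_prop) ε hε
  refine ⟨q, hq, fun t ht => ?_⟩
  have h := hnear ⟨t, ht⟩
  rw [Real.norm_eq_abs, abs_sub_comm] at h
  simpa [hφ] using h.le

/-- Every function of polynomial growth is a weighted uniform limit of members of the class. -/
lemma exists_near (hC : IsFunctionClass C) {f : (Fin n → ℝ) → ℝ} (hf : Continuous f) {M : ℝ}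
    {N : ℕ} (hfM : ∀ t, |f t| ≤ M * growthWeight n t ^ N) {ε : ℝ} (hε : 0 < ε) :
    ∃ q, C q ∧ ∀ t, |f t - q t| ≤ ε * growthWeight n t ^ (N + 1) := by
  set R : ℝ := 2 * M / ε with hR
  obtain ⟨p, hp, hfp⟩ :=
    hC.exists_near_on_compact (isCompact_growthWeight_le n (R + 1)) hf (half_pos hε)
  set χ : (Fin n → ℝ) → ℝ := ((fun _ => R + 1) - growthWeight n) ⊓ (fun _ => 1) ⊔ fun _ => 0
    with hχ
  have hCχ : C χ :=
    hC.sup _ _ (hC.inf (hC.sub (hC.const _) hC.weight) (hC.const 1)) (hC.const 0)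
  have hχt : ∀ t, χ t = max (min (R + 1 - growthWeight n t) 1) 0 := fun _ => rfl
  refine ⟨p * χ, hC.mul _ _ hp hCχ, fun t => ?_⟩
  have hw := one_le_growthWeight t
  have hW : 1 ≤ growthWeight n t ^ (N + 1) := one_le_pow₀ hw
  have hχ0 : 0 ≤ χ t := le_max_right _ _
  have hχ1 : χ t ≤ 1 := max_le (min_le_right _ _) zero_le_one
  have h1 : |f t - p t| * χ t ≤ ε / 2 := by
    rcases le_or_gt (growthWeight n t) (R + 1) with h | h
    · exact (mul_le_of_le_one_right (abs_nonneg _) hχ1).trans (hfp t h)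
    · have h0 : χ t = 0 := by
        rw [hχt, max_eq_right]
        exact (min_le_left _ _).trans (by linarith)
      rw [h0, mul_zero]
      positivity
  have h2 : |f t| * (1 - χ t) ≤ ε / 2 * growthWeight n t ^ (N + 1) := by
    rcases le_or_gt (growthWeight n t) R with h | h
    · have h0 : χ t = 1 := by
        rw [hχt, min_eq_right (by linarith), max_eq_left zero_le_one]
      rw [h0, sub_self, mul_zero]
      positivity
    · have h3 : M ≤ ε / 2 * growthWeight n t := by
        rw [hR, div_lt_iff₀ hε] at h
        linarith
      calc |f t| * (1 - χ t) ≤ |f t| := mul_le_of_le_one_right (abs_nonneg _) (by linarith)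
        _ ≤ M * growthWeight n t ^ N := hfM t
        _ ≤ ε / 2 * growthWeight n t * growthWeight n t ^ N := by gcongr
        _ = ε / 2 * growthWeight n t ^ (N + 1) := by ring
  calc |f t - (p * χ) t| = |(f t - p t) * χ t + f t * (1 - χ t)| := by
        rw [Pi.mul_apply]
        ring_nf
    _ ≤ |f t - p t| * χ t + |f t| * (1 - χ t) := by
        refine (abs_add_le _ _).trans_eq ?_
        rw [abs_mul, abs_mul, abs_of_nonneg hχ0, abs_of_nonneg (sub_nonneg.2 hχ1)]
    _ ≤ ε / 2 * growthWeight n t ^ (N + 1) + ε / 2 * growthWeight n t ^ (N + 1) :=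
        add_le_add (h1.trans (le_mul_of_one_le_right (by positivity) hW)) h2
    _ = ε * growthWeight n t ^ (N + 1) := by ring

end IsFunctionClass

namespace PolyGrowth

variable {n : ℕ} {f g : (Fin n → ℝ) → ℝ}

lemma of_bound (hf : Continuous f) {M : ℝ} {N : ℕ} (hM : 0 ≤ M)
    (h : ∀ t, |f t| ≤ M * growthWeight n t ^ N) : PolyGrowth n f :=
  ⟨hf, M, N, hM, h⟩

lemma const (n : ℕ) (c : ℝ) : PolyGrowth n fun _ => c :=
  of_bound (N := 0) continuous_const (abs_nonneg c) fun t => by simp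

lemma coord (i : Fin n) : PolyGrowth n fun t => t i := by
  refine of_bound (M := 1) (N := 1) (continuous_apply i) zero_le_one fun t => ?_
  have h1 : |t i| ≤ ∑ j, |t j| :=
    Finset.single_le_sum (f := fun j => |t j|) (fun _ _ => abs_nonneg _) (Finset.mem_univ i)
  rw [one_mul, pow_one, growthWeight]
  linarith

lemma of_abs_le_add {k : (Fin n → ℝ) → ℝ} (hk : Continuous k) (hf : PolyGrowth n f)
    (hg : PolyGrowth n g) (h : ∀ t, |k t| ≤ |f t| + |g t|) : PolyGrowth n k := by
  obtain ⟨-, M, N, hM, hf⟩ := hf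
  obtain ⟨-, M', N', hM', hg⟩ := hg
  refine of_bound (M := M + M') (N := N + N') hk (by positivity) fun t => ?_
  have hw := one_le_growthWeight t
  have h1 : growthWeight n t ^ N ≤ growthWeight n t ^ (N + N') :=
    pow_le_pow_right₀ hw (Nat.le_add_right _ _)
  have h2 : growthWeight n t ^ N' ≤ growthWeight n t ^ (N + N') :=
    pow_le_pow_right₀ hw (Nat.le_add_left _ _)
  rw [add_mul]
  exact (h t).trans (add_le_add ((hf t).trans (mul_le_mul_of_nonneg_left h1 hM))
    ((hg t).trans (mul_le_mul_of_nonneg_left h2 hM')))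

lemma add (hf : PolyGrowth n f) (hg : PolyGrowth n g) : PolyGrowth n (f + g) :=
  of_abs_le_add (hf.1.add hg.1) hf hg fun _ => abs_add_le _ _

lemma sup (hf : PolyGrowth n f) (hg : PolyGrowth n g) : PolyGrowth n (f ⊔ g) :=
  of_abs_le_add (hf.1.max hg.1) hf hg fun _ =>
    abs_max_le_max_abs_abs.trans (max_le_add_of_nonneg (abs_nonneg _) (abs_nonneg _))

lemma mul (hf : PolyGrowth n f) (hg : PolyGrowth n g) : PolyGrowth n (f * g) := by
  refine ⟨hf.1.mul hg.1, ?_⟩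
  obtain ⟨-, M, N, hM, hf⟩ := hf
  obtain ⟨-, M', N', hM', hg⟩ := hg
  refine ⟨M * M', N + N', by positivity, fun t => ?_⟩
  rw [Pi.mul_apply, abs_mul, pow_add, mul_mul_mul_comm]
  exact mul_le_mul (hf t) (hg t) (abs_nonneg _) ((abs_nonneg _).trans (hf t))

lemma smul (c : ℝ) (hf : PolyGrowth n f) : PolyGrowth n (c • f) :=
  (const n c).mul hf

end PolyGrowth

namespace IsArchFAlgebra

variable {A : Type*} [Lattice A] [CommRing A] [Module ℝ A] {n : ℕ}

lemma regNorm_le {e x : A} {c : ℝ} (hc : 0 ≤ c) (h : |x| ≤ c • e) : regNorm e x ≤ c :=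
  csInf_le ⟨0, fun _ h => h.1⟩ ⟨hc, h⟩

section Uniqueness

variable {Φ Ψ : ∀ f : (Fin n → ℝ) → ℝ, PolyGrowth n f → A}

lemma hom_mono (hΦ : IsLatAlgHom (PolyGrowth n) Φ) {f g : (Fin n → ℝ) → ℝ}
    (hf : PolyGrowth n f) (hg : PolyGrowth n g) (h : f ≤ g) : Φ f hf ≤ Φ g hg := by
  have h1 := hΦ.1.2.2 f g hf hg (hf.sup hg)
  simp only [sup_eq_right.2 h] at h1
  rw [h1]
  exact le_sup_left

lemma isFunctionClass_eq (hΦ : IsLatAlgHom (PolyGrowth n) Φ)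
    (hΨ : IsLatAlgHom (PolyGrowth n) Ψ)
    (h1 : ∀ h : PolyGrowth n 1, Φ 1 h = Ψ 1 h)
    (hc : ∀ (i : Fin n) (h : PolyGrowth n fun t => t i), Φ _ h = Ψ _ h) :
    IsFunctionClass fun f => ∃ hf : PolyGrowth n f, Φ f hf = Ψ f hf where
  const c := by
    have h : PolyGrowth n (c • (1 : (Fin n → ℝ) → ℝ)) := (PolyGrowth.const n 1).smul c
    have key : Φ _ h = Ψ _ h := by
      rw [hΦ.1.2.1 c 1 (PolyGrowth.const n 1) h, hΨ.1.2.1 c 1 (PolyGrowth.const n 1) h, h1]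
    have hfun : (c • (1 : (Fin n → ℝ) → ℝ)) = fun _ => c := by
      ext t
      simp
    exact hfun ▸ ⟨h, key⟩
  coord i := ⟨PolyGrowth.coord i, hc i _⟩
  add := by
    rintro f g ⟨hf, h⟩ ⟨hg, h'⟩
    exact ⟨hf.add hg, by rw [hΦ.1.1 f g hf hg, hΨ.1.1 f g hf hg, h, h']⟩
  mul := by
    rintro f g ⟨hf, h⟩ ⟨hg, h'⟩
    exact ⟨hf.mul hg, by rw [hΦ.2 f g hf hg, hΨ.2 f g hf hg, h, h']⟩
  sup := by
    rintro f g ⟨hf, h⟩ ⟨hg, h'⟩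
    exact ⟨hf.sup hg, by rw [hΦ.1.2.2 f g hf hg, hΨ.1.2.2 f g hf hg, h, h']⟩

lemma hom_le_add (hΦ : IsLatAlgHom (PolyGrowth n) Φ) {f g p : (Fin n → ℝ) → ℝ}
    (hf : PolyGrowth n f) (hg : PolyGrowth n g) (hp : PolyGrowth n p) (ε : ℝ)
    (h : ∀ t, f t - g t ≤ ε * p t) : Φ f hf ≤ Φ g hg + ε • Φ p hp := by
  rw [← hΦ.1.2.1 ε p hp (hp.smul ε), ← hΦ.1.1 _ _ hg _ (hg.add (hp.smul ε))]
  exact hom_mono hΦ _ _ fun t => sub_le_iff_le_add'.1 (h t)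

variable [IsArchFAlgebra A]

lemma hom_le_hom (hΦ : IsLatAlgHom (PolyGrowth n) Φ) (hΨ : IsLatAlgHom (PolyGrowth n) Ψ)
    (h1 : ∀ h : PolyGrowth n 1, Φ 1 h = Ψ 1 h)
    (hc : ∀ (i : Fin n) (h : PolyGrowth n fun t => t i), Φ _ h = Ψ _ h)
    (f : (Fin n → ℝ) → ℝ) (hf : PolyGrowth n f) : Φ f hf ≤ Ψ f hf := by
  have hC := isFunctionClass_eq hΦ hΨ h1 hc
  obtain ⟨hcont, M, N, hM, hbound⟩ := id hf
  obtain ⟨hp, hpe⟩ := hC.pow hC.weight (N + 1)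
  have hp0 : 0 ≤ Φ _ hp := by
    have h0 := hom_mono hΦ (hp.smul 0) hp fun t => by
      simpa using pow_nonneg (zero_le_one.trans (one_le_growthWeight t)) (N + 1)
    rwa [hΦ.1.2.1 0 _ hp, zero_smul] at h0
  rw [← sub_nonpos]
  refine nonpos_of_forall_le_smul hp0 fun ε hε => ?_
  obtain ⟨q, ⟨hq, hqe⟩, hfq⟩ := hC.exists_near hcont hbound (half_pos hε)
  have h2 := hom_le_add hΦ hf hq hp (ε / 2) fun t => (le_abs_self _).trans (hfq t)
  have h3 := hom_le_add hΨ hq hf hp (ε / 2) fun t => by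
    rw [← neg_sub]
    exact (neg_le_abs _).trans (hfq t)
  rw [← hqe, ← hpe] at h3
  rw [sub_le_iff_le_add']
  refine h2.trans ((add_le_add_left h3 _).trans_eq ?_)
  rw [add_assoc, ← add_smul, add_halves]

end Uniqueness

section Existence

variable [IsArchFAlgebra A]

lemma isFunctionClass_isValue (a : Fin n → A) :
    IsFunctionClass fun f => ∃ z, IsValue a f z where
  const c := ⟨_, IsValue.const a c⟩
  coord i := ⟨_, IsValue.coord a i⟩
  add := fun _ _ ⟨_, h⟩ ⟨_, h'⟩ => ⟨_, h.add h'⟩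
  mul := fun _ _ ⟨_, h⟩ ⟨_, h'⟩ => ⟨_, h.mul h'⟩
  sup := fun _ _ ⟨_, h⟩ ⟨_, h'⟩ => ⟨_, h.sup h'⟩

lemma abs_le_of_regNorm_lt {e x : A} (he : 0 ≤ e) (hx : x ∈ idealSet e) {ε : ℝ}
    (h : regNorm e x < ε) : |x| ≤ ε • e := by
  obtain ⟨c, ⟨-, hc⟩, hcε⟩ := exists_lt_of_csInf_lt hx h
  exact hc.trans (smul_le_smul_of_nonneg_right hcε.le he)

lemma sub_mem_idealSet {e x y : A} (hx : x ∈ idealSet e) (hy : y ∈ idealSet e) :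
    x - y ∈ idealSet e := by
  obtain ⟨c, hc, hx⟩ := hx
  obtain ⟨d, hd, hy⟩ := hy
  refine ⟨c + d, add_nonneg hc hd, ?_⟩
  rw [sub_eq_add_neg, add_smul]
  refine (abs_add_le _ _).trans (add_le_add hx ?_)
  rwa [abs_neg]

lemma exists_isValue (huc : UniformlyComplete A) (a : Fin n → A) {f : (Fin n → ℝ) → ℝ}
    (hf : PolyGrowth n f) : ∃ z, IsValue a f z := by
  have hC := isFunctionClass_isValue a
  obtain ⟨hcont, M, N, hM, hbound⟩ := hf
  set p : (Fin n → ℝ) → ℝ := growthWeight n ^ (N + 1) with hp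
  have hp1 : ∀ t, 1 ≤ p t := fun t => one_le_pow₀ (one_le_growthWeight t)
  obtain ⟨v, hv⟩ : ∃ v, IsValue a p v := hC.pow hC.weight (N + 1)
  have hv0 : 0 ≤ v := hv.nonneg fun t => zero_le_one.trans (hp1 t)
  have hex : ∀ k : ℕ, ∃ q y, IsValue a q y ∧ ∀ t, |f t - q t| ≤ 1 / ((k : ℝ) + 1) * p t :=
    fun k => by
      obtain ⟨q, ⟨y, hy⟩, hq⟩ := hC.exists_near hcont hbound
        (ε := 1 / ((k : ℝ) + 1)) (by positivity)
      exact ⟨q, y, hy, hq⟩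
  choose q y hy hq using hex
  have hmem : ∀ k, y k ∈ idealSet v := fun k => by
    refine ⟨M + 1, by positivity, (hy k).abs_le (hv.smul (M + 1)) fun t => ?_⟩
    have h1 : |f t| ≤ M * p t := (hbound t).trans (mul_le_mul_of_nonneg_left
      (pow_le_pow_right₀ (one_le_growthWeight t) (Nat.le_succ N)) hM)
    have h2 : 1 / ((k : ℝ) + 1) * p t ≤ 1 * p t := by
      refine mul_le_mul_of_nonneg_right ?_ (zero_le_one.trans (hp1 t))
      exact (div_le_one (by positivity)).2 (by linarith [k.cast_nonneg (α := ℝ)])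
    have h3 := hq k t
    have h4 := abs_sub_abs_le_abs_sub (q k t) (f t)
    rw [abs_sub_comm] at h4
    change |q k t| ≤ (M + 1) * p t
    linarith
  have hdist : ∀ j k, |y j - y k| ≤ (1 / ((j : ℝ) + 1) + 1 / ((k : ℝ) + 1)) • v := fun j k => by
    refine ((hy j).sub (hy k)).abs_le (hv.smul _) fun t => ?_
    have h1 := abs_sub_le (q j t) (f t) (q k t)
    rw [abs_sub_comm (q j t) (f t)] at h1
    change |q j t - q k t| ≤ (1 / ((j : ℝ) + 1) + 1 / ((k : ℝ) + 1)) * p t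
    linarith [hq j t, hq k t]
  have hlim := tendsto_one_div_add_atTop_nhds_zero_nat (𝕜 := ℝ)
  have hsmall : ∀ ε : ℝ, 0 < ε → ∃ K : ℕ, ∀ k, K ≤ k → 1 / ((k : ℝ) + 1) < ε := fun ε hε =>
    Filter.eventually_atTop.1 (hlim.eventually (gt_mem_nhds hε))
  obtain ⟨z, hz, hyz⟩ := huc v hv0 y hmem fun ε hε => by
    obtain ⟨K, hK⟩ := hsmall (ε / 2) (half_pos hε)
    refine ⟨K, fun j k hj hk => (regNorm_le (by positivity) (hdist j k)).trans_lt ?_⟩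
    linarith [hK j hj, hK k hk]
  refine ⟨z, IsValue.of_approx hv fun ε hε => ?_⟩
  obtain ⟨K, hK⟩ := hsmall ε hε
  obtain ⟨L, hL⟩ := hyz ε hε
  refine ⟨q (max K L), y (max K L), hy _, fun t => (hq _ t).trans ?_, ?_⟩
  · exact mul_le_mul_of_nonneg_right (hK _ (le_max_left _ _)).le (zero_le_one.trans (hp1 t))
  · exact abs_le_of_regNorm_lt hv0 (sub_mem_idealSet (hmem _) hz) (hL _ (le_max_right _ _))

end Existence

theorem existsUnique_functional_calculus [IsArchFAlgebra A] (huc : UniformlyComplete A)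
    (a : Fin n → A) :
    ∃ Ψ : ∀ f : (Fin n → ℝ) → ℝ, PolyGrowth n f → A,
      (IsLatAlgHom (PolyGrowth n) Ψ ∧ (∀ h1 : PolyGrowth n 1, Ψ 1 h1 = 1) ∧
        ∀ (i : Fin n) (hi : PolyGrowth n fun t => t i), Ψ (fun t => t i) hi = a i) ∧
      ∀ Ψ' : ∀ f : (Fin n → ℝ) → ℝ, PolyGrowth n f → A,
        (IsLatAlgHom (PolyGrowth n) Ψ' ∧ (∀ h1 : PolyGrowth n 1, Ψ' 1 h1 = 1) ∧
          ∀ (i : Fin n) (hi : PolyGrowth n fun t => t i), Ψ' (fun t => t i) hi = a i) →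
        ∀ (f : (Fin n → ℝ) → ℝ) (hf : PolyGrowth n f), Ψ' f hf = Ψ f hf := by
  choose Ψ hΨ using fun (f : (Fin n → ℝ) → ℝ) (hf : PolyGrowth n f) => exists_isValue huc a hf
  have hhom : IsLatAlgHom (PolyGrowth n) Ψ :=
    ⟨⟨fun f g hf hg hfg => (hΨ _ hfg).unique ((hΨ f hf).add (hΨ g hg)),
      fun c f hf hcf => (hΨ _ hcf).unique ((hΨ f hf).smul c),
      fun f g hf hg hfg => (hΨ _ hfg).unique ((hΨ f hf).sup (hΨ g hg))⟩,
      fun f g hf hg hfg => (hΨ _ hfg).unique ((hΨ f hf).mul (hΨ g hg))⟩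
  have hone : ∀ h1 : PolyGrowth n 1, Ψ 1 h1 = 1 := fun h1 => by
    have h := IsValue.const a 1
    rw [one_smul] at h
    exact (hΨ _ h1).unique h
  have hcoord : ∀ (i : Fin n) (hi : PolyGrowth n fun t => t i), Ψ (fun t => t i) hi = a i :=
    fun i hi => (hΨ _ hi).unique (IsValue.coord a i)
  refine ⟨Ψ, ⟨hhom, hone, hcoord⟩, fun Ψ' ⟨hhom', hone', hcoord'⟩ f hf => le_antisymm ?_ ?_⟩
  · exact hom_le_hom hhom' hhom (fun h => (hone' h).trans (hone h).symm)
      (fun i h => (hcoord' i h).trans (hcoord i h).symm) f hf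
  · exact hom_le_hom hhom hhom' (fun h => (hone h).trans (hone' h).symm)
      (fun i h => (hcoord i h).trans (hcoord' i h).symm) f hf

end IsArchFAlgebra

/-- `PG_n` is the free uniformly complete `f`-algebra with identity on `n`
generators: every uniformly complete Archimedean `f`-algebra with identity admits a unique
polynomial growth continuous function calculus at each `n`-tuple. -/
theorem stmt_6 {A : Type*} [Lattice A] [Ring A] [Module ℝ A]
    [CovariantClass A A (· + ·) (· ≤ ·)] [IsScalarTower ℝ A A] [SMulCommClass ℝ A A]
    (hsmulpos : ∀ (c : ℝ) (a : A), 0 ≤ c → 0 ≤ a → 0 ≤ c • a)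
    (hmulpos : ∀ a b : A, 0 ≤ a → 0 ≤ b → 0 ≤ a * b)
    (hfalg : ∀ a b z : A, a ⊓ b = 0 → 0 ≤ z → (z * a) ⊓ b = 0 ∧ (a * z) ⊓ b = 0)
    (harch : ∀ a b : A, 0 ≤ a → 0 ≤ b → (∀ k : ℕ, k • a ≤ b) → a = 0)
    (huc : UniformlyComplete A)
    (n : ℕ) (a : Fin n → A) :
    ∃ Ψ : ∀ f : (Fin n → ℝ) → ℝ, PolyGrowth n f → A,
      (IsLatAlgHom (PolyGrowth n) Ψ ∧ (∀ h1 : PolyGrowth n 1, Ψ 1 h1 = 1) ∧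
        ∀ (i : Fin n) (hi : PolyGrowth n fun t => t i), Ψ (fun t => t i) hi = a i) ∧
      ∀ Ψ' : ∀ f : (Fin n → ℝ) → ℝ, PolyGrowth n f → A,
        (IsLatAlgHom (PolyGrowth n) Ψ' ∧ (∀ h1 : PolyGrowth n 1, Ψ' 1 h1 = 1) ∧
          ∀ (i : Fin n) (hi : PolyGrowth n fun t => t i), Ψ' (fun t => t i) hi = a i) →
        ∀ (f : (Fin n → ℝ) → ℝ) (hf : PolyGrowth n f), Ψ' f hf = Ψ f hf := by
  have hord : IsOrderedAddMonoid A :=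
    { add_le_add_left := fun x y h z => by
        rw [add_comm x, add_comm y]
        exact CovariantClass.elim z h }
  have hinst : IsArchFAlgebra A :=
    { hord with
      smul_le_smul_of_nonneg_left := fun c hc x y h => by
        rw [← sub_nonneg, ← smul_sub]
        exact hsmulpos _ _ hc (sub_nonneg.2 h)
      smul_le_smul_of_nonneg_right := fun x hx c d h => by
        rw [← sub_nonneg, ← sub_smul]
        exact hsmulpos _ _ (sub_nonneg.2 h) hx
      mul_le_mul_of_nonneg_left := fun z hz x y h => by
        rw [← sub_nonneg, ← mul_sub]
        exact hmulpos _ _ hz (sub_nonneg.2 h)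
      mul_le_mul_of_nonneg_right := fun z hz x y h => by
        rw [← sub_nonneg, ← sub_mul]
        exact hmulpos _ _ (sub_nonneg.2 h) hz
      smul_assoc := smul_assoc
      smul_comm := smul_comm
      mul_inf_eq_zero := hfalg
      eq_zero_of_nsmul_le := harch }
  let _ : CommRing A := { ‹Ring A› with mul_comm := IsArchFAlgebra.mul_comm' }
  exact IsArchFAlgebra.existsUnique_functional_calculus huc a
end
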